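/- arXiv:1108.0723 — 2 statements merged into one kernel-verified Lean document; each statement's English description precedes it below -/
import Mathlib

section
/- Let H₁ be holomorphic on {u ∈ ℂ : Re u > −1/2}, and suppose that for all reals a ≤ b with a ≥ −1/4 there is a constant C_{a,b} > 0 such that |H₁(σ + it)| ≤ C_{a,b}·e^{−|t|} for all σ ∈ [a, b] and t ∈ ℝ. For x > 0 define V(x) = (1/2πi)·∫_{Re u = 1} x^{−u}·H₁(u)·u^{−1} du. Then V is smooth on (0, ∞), and for every integer a ≥ 0 and every A > 0 there exists C > 0 such that |x^{a}·V^{(a)}(x)| ≤ C·(1 + x)^{−A} for all x > 0. -/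
open Complex Real

/-- `V(x) = (1/2πi) ∫_{Re u = 1} x^{-u} H₁(u) u⁻¹ du`, parametrizing the line by `u = 1 + it`. -/
noncomputable def Vfun (H₁ : ℂ → ℂ) (x : ℝ) : ℂ :=
  (2 * Real.pi * Complex.I)⁻¹ *
    ∫ t : ℝ, (x : ℂ) ^ (-(1 + t * Complex.I)) * H₁ (1 + t * Complex.I) *
      (1 + t * Complex.I)⁻¹ * Complex.I

/-- `G` decays faster than any power of `|Im u|`, uniformly over real parts in `s`. -/
def RapidDecayOn (G : ℂ → ℂ) (s : Set ℝ) : Prop :=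
  ∀ n : ℕ, ∃ C : ℝ, ∀ σ ∈ s, ∀ t : ℝ, (1 + |t|) ^ n * ‖G (σ + t * I)‖ ≤ C

namespace RapidDecayOn

variable {G : ℂ → ℂ} {s : Set ℝ}

lemma mono {s' : Set ℝ} (h : RapidDecayOn G s) (hs : s' ⊆ s) : RapidDecayOn G s' := fun n ↦
  (h n).imp fun _ hC σ hσ ↦ hC σ (hs hσ)

lemma of_exp_bound {C : ℝ}
    (h : ∀ σ ∈ s, ∀ t : ℝ, ‖G (σ + t * I)‖ ≤ C * Real.exp (-|t|)) : RapidDecayOn G s := by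
  intro n
  refine ⟨n.factorial * Real.exp 1 * C, fun σ hσ t ↦ ?_⟩
  have h1 : (1 + |t|) ^ n ≤ n.factorial * (Real.exp 1 * Real.exp |t|) := by
    have := Real.pow_div_factorial_le_exp (1 + |t|) (by positivity) n
    rw [div_le_iff₀ (by positivity), Real.exp_add] at this
    linarith
  calc (1 + |t|) ^ n * ‖G (σ + t * I)‖
      ≤ (n.factorial * (Real.exp 1 * Real.exp |t|)) * (C * Real.exp (-|t|)) :=
        mul_le_mul h1 (h σ hσ t) (norm_nonneg _) (by positivity)
    _ = n.factorial * Real.exp 1 * C * (Real.exp |t| * Real.exp (-|t|)) := by ring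
    _ = n.factorial * Real.exp 1 * C := by rw [← Real.exp_add]; simp

lemma bounded_mul {g : ℂ → ℂ} {M : ℝ} (h : RapidDecayOn G s)
    (hg : ∀ σ ∈ s, ∀ t : ℝ, ‖g (σ + t * I)‖ ≤ M) : RapidDecayOn (fun u ↦ g u * G u) s := by
  intro n
  obtain ⟨C, hC⟩ := h n
  refine ⟨M * C, fun σ hσ t ↦ ?_⟩
  have hM := (norm_nonneg _).trans (hg σ hσ t)
  calc (1 + |t|) ^ n * ‖g (σ + t * I) * G (σ + t * I)‖
      = ‖g (σ + t * I)‖ * ((1 + |t|) ^ n * ‖G (σ + t * I)‖) := by rw [norm_mul]; ring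
    _ ≤ M * C := mul_le_mul (hg σ hσ t) (hC σ hσ t) (by positivity) hM

lemma neg_sub_mul (h : RapidDecayOn G s) (hs : Bornology.IsBounded s) (c : ℂ) :
    RapidDecayOn (fun u ↦ (-u - c) * G u) s := by
  intro n
  obtain ⟨C, hC⟩ := h (n + 1)
  obtain ⟨R, hR0, hR⟩ := hs.exists_pos_norm_le
  refine ⟨(R + ‖c‖ + 1) * C, fun σ hσ t ↦ ?_⟩
  have h1 : ‖-(σ + t * I : ℂ) - c‖ ≤ (R + ‖c‖ + 1) * (1 + |t|) := by
    have h2 : ‖-(σ + t * I : ℂ) - c‖ ≤ |σ| + |t| + ‖c‖ := by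
      refine (norm_sub_le _ _).trans ?_
      rw [norm_neg]
      gcongr
      refine (norm_add_le _ _).trans ?_
      simp
    have h3 := hR σ hσ
    rw [Real.norm_eq_abs] at h3
    nlinarith [abs_nonneg t, norm_nonneg c, mul_nonneg (add_nonneg hR0.le (norm_nonneg c))
      (abs_nonneg t)]
  calc (1 + |t|) ^ n * ‖(-(σ + t * I : ℂ) - c) * G (σ + t * I)‖
      = ‖-(σ + t * I : ℂ) - c‖ * ((1 + |t|) ^ n * ‖G (σ + t * I)‖) := by rw [norm_mul]; ring
    _ ≤ (R + ‖c‖ + 1) * (1 + |t|) * ((1 + |t|) ^ n * ‖G (σ + t * I)‖) := by gcongr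
    _ = (R + ‖c‖ + 1) * ((1 + |t|) ^ (n + 1) * ‖G (σ + t * I)‖) := by ring
    _ ≤ (R + ‖c‖ + 1) * C := by gcongr; exact hC σ hσ t

lemma prod_neg_sub_mul (h : RapidDecayOn G s) (hs : Bornology.IsBounded s) (c : ℕ → ℂ) (k : ℕ) :
    RapidDecayOn (fun u ↦ (∏ j ∈ Finset.range k, (-u - c j)) * G u) s := by
  induction k with
  | zero => simpa using h
  | succ k ih =>
    simpa only [Finset.prod_range_succ, mul_comm, mul_left_comm, mul_assoc]
      using ih.neg_sub_mul hs (c k)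

lemma exists_le_inv_one_add_sq (h : RapidDecayOn G s) :
    ∃ C : ℝ, ∀ σ ∈ s, ∀ t : ℝ, ‖G (σ + t * I)‖ ≤ C * (1 + t ^ 2)⁻¹ := by
  obtain ⟨C, hC⟩ := h 2
  refine ⟨C, fun σ hσ t ↦ ?_⟩
  rw [← div_eq_mul_inv, le_div_iff₀ (by positivity)]
  refine le_trans ?_ (hC σ hσ t)
  rw [mul_comm]
  gcongr
  nlinarith [abs_nonneg t, sq_abs t]

lemma integrable {σ : ℝ} (h : RapidDecayOn G {σ}) (hc : Continuous fun t : ℝ ↦ G (σ + t * I)) :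
    MeasureTheory.Integrable fun t : ℝ ↦ G (σ + t * I) := by
  obtain ⟨C, hC⟩ := h.exists_le_inv_one_add_sq
  exact (integrable_inv_one_add_sq.const_mul C).mono' hc.aestronglyMeasurable
    (Filter.Eventually.of_forall fun t ↦ hC σ rfl t)

lemma cpow_mul {a b : ℝ} (h : RapidDecayOn G (Set.Icc a b)) {x : ℝ} (hx : 0 < x) :
    RapidDecayOn (fun u ↦ (x : ℂ) ^ (-u) * G u) (Set.Icc a b) := by
  obtain ⟨M, hM⟩ := (isCompact_Icc (a := a) (b := b)).exists_bound_of_continuousOn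
    (f := fun σ ↦ x ^ (-σ))
    (continuous_const.rpow continuous_neg fun _ ↦ Or.inl hx.ne').continuousOn
  refine h.bounded_mul (M := M) fun σ hσ t ↦ ?_
  refine le_trans (le_of_eq ?_) ((le_abs_self _).trans (hM σ hσ))
  rw [Complex.norm_cpow_eq_rpow_re_of_pos hx]
  simp

end RapidDecayOn

lemma continuous_vertical_line {G : ℂ → ℂ} {s : Set ℝ} (h : ContinuousOn G (re ⁻¹' s)) {σ : ℝ}
    (hσ : σ ∈ s) : Continuous fun t : ℝ ↦ G (σ + t * I) :=
  h.comp_continuous (by fun_prop) fun t ↦ by simpa using hσ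

/-- The integrals over two vertical lines agree when the function is holomorphic and rapidly
decaying on the strip between them. -/
lemma integral_vertical_eq {F : ℂ → ℂ} {a b : ℝ} (hab : a ≤ b)
    (hd : DifferentiableOn ℂ F (re ⁻¹' Set.Icc a b)) (hF : RapidDecayOn F (Set.Icc a b)) :
    ∫ t : ℝ, F (a + t * I) = ∫ t : ℝ, F (b + t * I) := by
  have hint : ∀ σ ∈ Set.Icc a b, Filter.Tendsto (fun T : ℝ ↦ ∫ t in (-T)..T, F (σ + t * I))
      Filter.atTop (nhds (∫ t : ℝ, F (σ + t * I))) := fun σ hσ ↦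
    MeasureTheory.intervalIntegral_tendsto_integral
      ((hF.mono (Set.singleton_subset_iff.2 hσ)).integrable
        (continuous_vertical_line hd.continuousOn hσ))
      Filter.tendsto_neg_atTop_atBot Filter.tendsto_id
  obtain ⟨C, hC⟩ := hF.exists_le_inv_one_add_sq
  have hlim : Filter.Tendsto (fun T : ℝ ↦ C * (1 + T ^ 2)⁻¹ * |b - a|) Filter.atTop (nhds 0) := by
    have h1 : Filter.Tendsto (fun T : ℝ ↦ (1 + T ^ 2)⁻¹) Filter.atTop (nhds 0) :=
      (Filter.tendsto_atTop_add_const_left _ 1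
        (Filter.tendsto_pow_atTop two_ne_zero)).inv_tendsto_atTop
    simpa using (h1.const_mul C).mul_const |b - a|
  have hhor : ∀ T : ℝ, ‖∫ σ in a..b, F (σ + T * I)‖ ≤ C * (1 + T ^ 2)⁻¹ * |b - a| := fun T ↦
    intervalIntegral.norm_integral_le_of_norm_le_const fun σ hσ ↦ by
      rw [Set.uIoc_of_le hab] at hσ
      exact hC σ ⟨hσ.1.le, hσ.2⟩ T
  have htop : Filter.Tendsto (fun T : ℝ ↦ ∫ σ in a..b, F (σ + T * I)) Filter.atTop (nhds 0) :=
    squeeze_zero_norm hhor hlim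
  have hbot : Filter.Tendsto (fun T : ℝ ↦ ∫ σ in a..b, F (σ + (-T : ℝ) * I)) Filter.atTop
      (nhds 0) :=
    squeeze_zero_norm (fun T ↦ by simpa using hhor (-T)) hlim
  have hrect : ∀ T : ℝ, (∫ σ in a..b, F (σ + (-T : ℝ) * I)) - (∫ σ in a..b, F (σ + T * I)) +
      I * (∫ t in (-T)..T, F (b + t * I)) - I * (∫ t in (-T)..T, F (a + t * I)) = 0 := by
    intro T
    have := Complex.integral_boundary_rect_eq_zero_of_differentiableOn F ⟨a, -T⟩ ⟨b, T⟩
      (hd.mono fun u hu ↦ by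
        have := (Complex.mem_reProdIm.1 hu).1
        rwa [Set.uIcc_of_le hab] at this)
    simpa using this
  have hlim' := ((hbot.sub htop).add ((hint b ⟨hab, le_rfl⟩).const_mul I)).sub
    ((hint a ⟨le_rfl, hab⟩).const_mul I)
  have h0 := tendsto_nhds_unique (hlim'.congr hrect) tendsto_const_nhds
  have h1 : I * ((∫ t : ℝ, F (b + t * I)) - ∫ t : ℝ, F (a + t * I)) = 0 := by
    linear_combination h0
  exact (sub_eq_zero.1 ((mul_eq_zero.1 h1).resolve_left I_ne_zero)).symm

lemma mellinInv_eq_of_rapidDecayOn {G : ℂ → ℂ} {a b : ℝ} (hab : a ≤ b)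
    (hd : DifferentiableOn ℂ G (re ⁻¹' Set.Icc a b)) (hG : RapidDecayOn G (Set.Icc a b))
    {x : ℝ} (hx : 0 < x) : mellinInv a G x = mellinInv b G x := by
  have hx' : (x : ℂ) ≠ 0 := mod_cast hx.ne'
  have hd' : DifferentiableOn ℂ (fun u ↦ (x : ℂ) ^ (-u) * G u) (re ⁻¹' Set.Icc a b) :=
    (differentiable_neg.const_cpow (Or.inl hx')).differentiableOn.mul hd
  simp only [mellinInv, smul_eq_mul]
  rw [integral_vertical_eq hab hd' (hG.cpow_mul hx)]

lemma mellinInv_congr {G K : ℂ → ℂ} {σ : ℝ} (h : ∀ u : ℂ, u.re = σ → G u = K u) (x : ℝ) :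
    mellinInv σ G x = mellinInv σ K x := by
  simp only [mellinInv]
  congr 2 with t
  rw [h _ (by simp)]

lemma exists_norm_mellinInv_le (σ : ℝ) (G : ℂ → ℂ) :
    ∃ C : ℝ, 0 ≤ C ∧ ∀ x : ℝ, 0 < x → ‖mellinInv σ G x‖ ≤ C * x ^ (-σ) := by
  refine ⟨(1 / (2 * π)) * ∫ t : ℝ, ‖G (σ + t * I)‖, by positivity, fun x hx ↦ ?_⟩
  rw [mellinInv, norm_smul, Real.norm_of_nonneg (by positivity), mul_assoc]
  gcongr
  refine (MeasureTheory.norm_integral_le_integral_norm _).trans (le_of_eq ?_)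
  rw [← MeasureTheory.integral_mul_const]
  congr 1 with t
  rw [norm_smul, Complex.norm_cpow_eq_rpow_re_of_pos hx, mul_comm]
  simp

lemma hasDerivAt_mellinInv {G : ℂ → ℂ} {σ : ℝ} (hc : Continuous fun t : ℝ ↦ G (σ + t * I))
    (hG : RapidDecayOn G {σ}) {x : ℝ} (hx : 0 < x) :
    HasDerivAt (mellinInv σ G) ((x : ℂ)⁻¹ * mellinInv σ (fun u ↦ -u * G u) x) x := by
  have hG' : RapidDecayOn (fun u ↦ -u * G u) {σ} := by
    simpa using hG.neg_sub_mul Bornology.isBounded_singleton 0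
  have hc' : Continuous fun t : ℝ ↦ -(σ + t * I : ℂ) * G (σ + t * I) :=
    Continuous.mul (by fun_prop) hc
  have hpow : ∀ y : ℝ, 0 < y → Continuous fun t : ℝ ↦ (y : ℂ) ^ (-(σ + t * I : ℂ)) := fun y hy ↦
    Continuous.const_cpow (by fun_prop) (Or.inl (mod_cast hy.ne'))
  have hnorm : ∀ y : ℝ, 0 < y → ∀ t : ℝ, ‖(y : ℂ) ^ (-(σ + t * I : ℂ))‖ = y ^ (-σ) :=
    fun y hy t ↦ by rw [Complex.norm_cpow_eq_rpow_re_of_pos hy]; simp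
  have hpos : ∀ y ∈ Set.Icc (x / 2) (2 * x), 0 < y := fun y hy ↦ by linarith [hy.1]
  obtain ⟨M, hM⟩ := (isCompact_Icc (a := x / 2) (b := 2 * x)).exists_bound_of_continuousOn
    (f := fun y : ℝ ↦ y⁻¹ * y ^ (-σ))
    (ContinuousOn.mul (continuousOn_id.inv₀ fun y hy ↦ (hpos y hy).ne')
      (continuousOn_id.rpow_const fun y hy ↦ Or.inl (hpos y hy).ne'))
  have key := (hasDerivAt_integral_of_dominated_loc_of_deriv_le (μ := MeasureTheory.volume)
    (F := fun (y : ℝ) (t : ℝ) ↦ (y : ℂ) ^ (-(σ + t * I : ℂ)) * G (σ + t * I))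
    (F' := fun (y : ℝ) (t : ℝ) ↦
      (y : ℂ)⁻¹ * ((y : ℂ) ^ (-(σ + t * I : ℂ)) * (-(σ + t * I : ℂ) * G (σ + t * I))))
    (bound := fun t : ℝ ↦ M * ‖-(σ + t * I : ℂ) * G (σ + t * I)‖)
    (x₀ := x) (s := Set.Icc (x / 2) (2 * x))
    (Icc_mem_nhds (by linarith) (by linarith)) ?_ ?_ ?_ ?_ ?_ ?_).2
  · have := key.const_smul (1 / (2 * π))
    rw [MeasureTheory.integral_const_mul, ← mul_smul_comm] at this
    exact this
  · filter_upwards [lt_mem_nhds hx] with y hy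
    exact ((hpow y hy).mul hc).aestronglyMeasurable
  · refine ((hG.integrable hc).norm.const_mul (x ^ (-σ))).mono'
      ((hpow x hx).mul hc).aestronglyMeasurable (Filter.Eventually.of_forall fun t ↦ ?_)
    rw [norm_mul, hnorm x hx]
  · exact (((hpow x hx).mul hc').const_mul _).aestronglyMeasurable
  · refine Filter.Eventually.of_forall fun t y hy ↦ ?_
    have hy0 := hpos y hy
    rw [norm_mul, norm_mul, hnorm y hy0, ← mul_assoc, norm_inv, Complex.norm_of_nonneg hy0.le]
    gcongr
    exact (le_abs_self _).trans (hM y hy)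
  · exact (hG'.integrable hc').norm.const_mul M
  · refine Filter.Eventually.of_forall fun t y hy ↦ ?_
    have hy0 := hpos y hy
    have hy' : (y : ℂ) ≠ 0 := mod_cast hy0.ne'
    have h1 := (((hasDerivAt_id (y : ℂ)).cpow_const (c := -(σ + t * I : ℂ))
      (Or.inl (by simpa using hy0))).comp_ofReal).mul_const (G (σ + t * I))
    refine h1.congr_deriv ?_
    simp only [id, Complex.cpow_sub _ _ hy', Complex.cpow_one]
    field_simp

lemma contDiffOn_mellinInv {G : ℂ → ℂ} {σ : ℝ} (hc : Continuous fun t : ℝ ↦ G (σ + t * I))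
    (hG : RapidDecayOn G {σ}) : ContDiffOn ℝ (⊤ : ℕ∞) (mellinInv σ G) (Set.Ioi 0) := by
  refine contDiffOn_infty.2 fun n ↦ ?_
  induction n generalizing G with
  | zero =>
    exact contDiffOn_zero.2 fun x hx ↦
      (hasDerivAt_mellinInv hc hG hx).continuousAt.continuousWithinAt
  | succ n ih =>
    have hG' : RapidDecayOn (fun u ↦ -u * G u) {σ} := by
      simpa using hG.neg_sub_mul Bornology.isBounded_singleton 0
    push_cast
    refine (contDiffOn_succ_iff_deriv_of_isOpen isOpen_Ioi).2 ⟨fun x hx ↦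
      (hasDerivAt_mellinInv hc hG hx).differentiableAt.differentiableWithinAt, by simp, ?_⟩
    have hinv : ContDiffOn ℝ n (fun x : ℝ ↦ (x : ℂ)⁻¹) (Set.Ioi 0) :=
      Complex.ofRealCLM.contDiff.contDiffOn.inv fun x hx ↦ by
        simpa using (Set.mem_Ioi.1 hx).ne'
    have hc' : Continuous fun t : ℝ ↦ -(σ + t * I : ℂ) * G (σ + t * I) :=
      Continuous.mul (by fun_prop) hc
    exact (hinv.mul (ih (G := fun u ↦ -u * G u) hc' hG')).congr fun x hx ↦ (hasDerivAt_mellinInv hc hG hx).deriv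

lemma mellinInv_neg_sub_mul {G : ℂ → ℂ} {σ : ℝ} (hc : Continuous fun t : ℝ ↦ G (σ + t * I))
    (hG : RapidDecayOn G {σ}) (c : ℂ) {x : ℝ} (hx : 0 < x) :
    mellinInv σ (fun u ↦ (-u - c) * G u) x =
      mellinInv σ (fun u ↦ -u * G u) x - c * mellinInv σ G x := by
  have hG' : RapidDecayOn (fun u ↦ -u * G u) {σ} := by
    simpa using hG.neg_sub_mul Bornology.isBounded_singleton 0
  have hpow : Continuous fun t : ℝ ↦ (x : ℂ) ^ (-(σ + t * I : ℂ)) :=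
    Continuous.const_cpow (by fun_prop) (Or.inl (mod_cast hx.ne'))
  rw [← Set.Icc_self] at hG hG'
  have h1 := hG.cpow_mul hx
  have h2 := hG'.cpow_mul hx
  rw [Set.Icc_self] at h1 h2
  simp only [mellinInv, smul_eq_mul]
  rw [mul_smul_comm, ← smul_sub, ← MeasureTheory.integral_const_mul,
    ← MeasureTheory.integral_sub (h2.integrable (hpow.mul (Continuous.mul (by fun_prop) hc)))
      ((h1.integrable (hpow.mul hc)).const_mul c)]
  congr 2 with t
  ring

lemma iteratedDeriv_mellinInv {G : ℂ → ℂ} {σ : ℝ} (hc : Continuous fun t : ℝ ↦ G (σ + t * I))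
    (hG : RapidDecayOn G {σ}) (k : ℕ) {x : ℝ} (hx : 0 < x) :
    iteratedDeriv k (mellinInv σ G) x =
      (x : ℂ) ^ (-k : ℤ) * mellinInv σ (fun u ↦ (∏ j ∈ Finset.range k, (-u - j)) * G u) x := by
  induction k generalizing x with
  | zero => simp
  | succ k ih =>
    set K : ℂ → ℂ := fun u ↦ (∏ j ∈ Finset.range k, (-u - j)) * G u with hK
    have hKc : Continuous fun t : ℝ ↦ K (σ + t * I) :=
      Continuous.mul (by fun_prop) hc
    have hKd : RapidDecayOn K {σ} :=
      hG.prod_neg_sub_mul Bornology.isBounded_singleton (fun j ↦ (j : ℂ)) k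
    have hx' : (x : ℂ) ≠ 0 := mod_cast hx.ne'
    have hderiv := (hasDerivAt_zpow (-k : ℤ) (x : ℂ) (Or.inl hx')).comp_ofReal.mul
      (hasDerivAt_mellinInv hKc hKd hx)
    have hloc : iteratedDeriv k (mellinInv σ G) =ᶠ[nhds x]
        fun y : ℝ ↦ (y : ℂ) ^ (-k : ℤ) * mellinInv σ K y := by
      filter_upwards [lt_mem_nhds hx] with y hy using ih hy
    have hprod : (fun u : ℂ ↦ (∏ j ∈ Finset.range (k + 1), (-u - j)) * G u) =
        fun u ↦ (-u - k) * K u := by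
      funext u
      rw [hK, Finset.prod_range_succ]
      ring
    rw [iteratedDeriv_succ, hloc.deriv_eq, hprod, mellinInv_neg_sub_mul hKc hKd k hx]
    refine hderiv.deriv.trans ?_
    rw [zpow_sub_one₀ hx', show (-(k + 1 : ℕ) : ℤ) = -k - 1 by push_cast; ring,
      zpow_sub_one₀ hx']
    push_cast
    ring

lemma one_le_mul_one_add_rpow_neg {x A : ℝ} (hx : 0 < x) (hx1 : x ≤ 1) (hA : 0 ≤ A) :
    1 ≤ 2 ^ A * (1 + x) ^ (-A) := by
  rw [Real.rpow_neg (by positivity), ← div_eq_mul_inv, one_le_div (by positivity)]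
  exact Real.rpow_le_rpow (by positivity) (by linarith) hA

lemma rpow_neg_le_mul_one_add_rpow_neg {x A : ℝ} (hx1 : 1 ≤ x) (hA : 0 ≤ A) :
    x ^ (-A) ≤ 2 ^ A * (1 + x) ^ (-A) := by
  have hx : 0 < x := by linarith
  rw [Real.rpow_neg hx.le, Real.rpow_neg (by positivity), ← div_eq_mul_inv,
    le_div_iff₀ (by positivity), inv_mul_le_iff₀ (by positivity), ← Real.mul_rpow hx.le zero_le_two]
  exact Real.rpow_le_rpow (by positivity) (by linarith) hA

lemma exists_bound_one_add_rpow_neg {g : ℝ → ℝ} {A C₀ C₁ : ℝ} (hA : 0 ≤ A)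
    (h0 : ∀ x : ℝ, 0 < x → x ≤ 1 → g x ≤ C₀) (h1 : ∀ x : ℝ, 1 ≤ x → g x ≤ C₁ * x ^ (-A)) :
    ∃ C : ℝ, 0 < C ∧ ∀ x : ℝ, 0 < x → g x ≤ C * (1 + x) ^ (-A) := by
  refine ⟨(|C₀| + |C₁| + 1) * 2 ^ A, by positivity, fun x hx ↦ ?_⟩
  rw [mul_assoc]
  rcases le_total x 1 with hx1 | hx1
  · calc g x ≤ (|C₀| + |C₁| + 1) * 1 := by
          linarith [h0 x hx hx1, le_abs_self C₀, abs_nonneg C₁]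
      _ ≤ _ := by gcongr; exact one_le_mul_one_add_rpow_neg hx hx1 hA
  · calc g x ≤ C₁ * x ^ (-A) := h1 x hx1
      _ ≤ (|C₀| + |C₁| + 1) * x ^ (-A) := by
          gcongr
          linarith [le_abs_self C₁, abs_nonneg C₀]
      _ ≤ _ := by gcongr; exact rpow_neg_le_mul_one_add_rpow_neg hx1 hA

/-- A function whose derivative is `O(x ^ (-3/4))` near `0` is bounded near `0`. -/
lemma norm_le_of_norm_deriv_le_rpow {f f' : ℝ → ℂ} {C : ℝ} (hC : 0 ≤ C)
    (hf : ∀ x : ℝ, 0 < x → HasDerivAt f (f' x) x)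
    (hf' : ∀ x : ℝ, 0 < x → ‖f' x‖ ≤ C * x ^ (-(3 / 4) : ℝ)) {x : ℝ} (hx : 0 < x) (hx1 : x ≤ 1) :
    ‖f x‖ ≤ ‖f 1‖ + 4 * C := by
  have hpos : ∀ y ∈ Set.Icc x 1, 0 < y := fun y hy ↦ hx.trans_le hy.1
  have hB : ∀ y : ℝ, 0 < y → HasDerivAt (fun y : ℝ ↦ 4 * C * (y ^ (1 / 4 : ℝ) - x ^ (1 / 4 : ℝ)))
      (C * y ^ (-(3 / 4) : ℝ)) y := fun y hy ↦ by
    refine (((Real.hasDerivAt_rpow_const (p := 1 / 4) (Or.inl hy.ne')).sub_const _).const_mul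
      (4 * C)).congr_deriv ?_
    norm_num
    ring
  have key := image_norm_le_of_norm_deriv_right_le_deriv_boundary'
    (f := fun y ↦ f y - f x) (f' := f') (a := x) (b := 1)
    (B := fun y : ℝ ↦ 4 * C * (y ^ (1 / 4 : ℝ) - x ^ (1 / 4 : ℝ)))
    (B' := fun y ↦ C * y ^ (-(3 / 4) : ℝ))
    (fun y hy ↦ ((hf y (hpos y hy)).sub_const _).continuousAt.continuousWithinAt)
    (fun y hy ↦ ((hf y (hpos y ⟨hy.1, hy.2.le⟩)).sub_const _).hasDerivWithinAt)
    (by simp)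
    (fun y hy ↦ (hB y (hpos y hy)).continuousAt.continuousWithinAt)
    (fun y hy ↦ (hB y (hpos y ⟨hy.1, hy.2.le⟩)).hasDerivWithinAt)
    (fun y hy ↦ hf' y (hpos y ⟨hy.1, hy.2.le⟩)) (x := 1) ⟨hx1, le_rfl⟩
  have h1 : 4 * C * ((1 : ℝ) ^ (1 / 4 : ℝ) - x ^ (1 / 4 : ℝ)) ≤ 4 * C := by
    rw [Real.one_rpow]
    nlinarith [Real.rpow_nonneg hx.le (1 / 4)]
  have h2 : ‖f x‖ ≤ ‖f 1‖ + ‖f 1 - f x‖ := by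
    simpa using norm_sub_le (f 1) (f 1 - f x)
  linarith

lemma Vfun_eq_mellinInv (H₁ : ℂ → ℂ) : Vfun H₁ = mellinInv 1 fun u ↦ H₁ u * u⁻¹ := by
  funext x
  rw [Vfun, MeasureTheory.integral_mul_const]
  simp only [mellinInv, smul_eq_mul, Complex.real_smul, ofReal_one, mul_assoc]
  push_cast
  field_simp

theorem stmt13 (H₁ : ℂ → ℂ)
    (hol : DifferentiableOn ℂ H₁ {u : ℂ | -(1/2) < u.re})
    (hdecay : ∀ a b : ℝ, -(1/4) ≤ a → a ≤ b →
      ∃ C : ℝ, 0 < C ∧ ∀ σ : ℝ, σ ∈ Set.Icc a b → ∀ t : ℝ,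
        ‖H₁ (σ + t * Complex.I)‖ ≤ C * Real.exp (-|t|)) :
    ContDiffOn ℝ (⊤ : ℕ∞) (Vfun H₁) (Set.Ioi 0) ∧
    ∀ (a : ℕ) (A : ℝ), 0 < A → ∃ C : ℝ, 0 < C ∧ ∀ x : ℝ, 0 < x →
      x ^ a * ‖iteratedDeriv a (Vfun H₁) x‖ ≤ C * (1 + x) ^ (-A) := by
  have hdecay' : ∀ a b : ℝ, -(1/4) ≤ a → RapidDecayOn H₁ (Set.Icc a b) := by
    intro a b ha
    rcases le_or_gt a b with hab | hab
    · obtain ⟨C, -, hC⟩ := hdecay a b ha hab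
      exact .of_exp_bound hC
    · exact fun n ↦ ⟨0, by simp [Set.Icc_eq_empty hab.not_ge]⟩
  have hdiff : ∀ a b : ℝ, -(1/4) ≤ a → DifferentiableOn ℂ H₁ (re ⁻¹' Set.Icc a b) :=
    fun a b ha ↦ hol.mono fun u hu ↦ by
      have : a ≤ u.re := hu.1
      show -(1 / 2) < u.re
      linarith
  have hre : ∀ b : ℝ, ∀ u ∈ re ⁻¹' Set.Icc 1 b, 1 ≤ u.re := fun b u hu ↦ hu.1
  have hGdiff : ∀ b : ℝ, DifferentiableOn ℂ (fun u ↦ H₁ u * u⁻¹) (re ⁻¹' Set.Icc 1 b) :=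
    fun b ↦ (hdiff 1 b (by norm_num)).mul (differentiableOn_id.inv fun u hu h ↦ by
      have := hre b u hu
      norm_num [show u = 0 from h] at this)
  have hGdecay : ∀ b : ℝ, RapidDecayOn (fun u ↦ H₁ u * u⁻¹) (Set.Icc 1 b) := fun b ↦ by
    simp only [mul_comm (H₁ _)]
    refine (hdecay' 1 b (by norm_num)).bounded_mul (M := 1) fun σ hσ t ↦ ?_
    rw [norm_inv]
    refine inv_le_one_of_one_le₀ (hσ.1.trans ((le_abs_self _).trans ?_))
    simpa using Complex.abs_re_le_norm (σ + t * I)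
  have hGc : Continuous fun t : ℝ ↦ H₁ ((1 : ℝ) + t * I) * ((1 : ℝ) + t * I : ℂ)⁻¹ :=
    continuous_vertical_line (hGdiff 1).continuousOn ⟨le_rfl, le_rfl⟩
  have hG1 : RapidDecayOn (fun u ↦ H₁ u * u⁻¹) {1} := by simpa using hGdecay 1
  rw [Vfun_eq_mellinInv]
  refine ⟨contDiffOn_mellinInv hGc hG1, fun k A hA ↦ ?_⟩
  have hnorm : ∀ x : ℝ, 0 < x →
      x ^ k * ‖iteratedDeriv k (mellinInv 1 fun u ↦ H₁ u * u⁻¹) x‖ =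
      ‖mellinInv 1 (fun u ↦ (∏ j ∈ Finset.range k, (-u - j)) * (H₁ u * u⁻¹)) x‖ := by
    intro x hx
    rw [iteratedDeriv_mellinInv hGc hG1 k hx, norm_mul, ← mul_assoc, norm_zpow,
      Complex.norm_of_nonneg hx.le, zpow_neg, zpow_natCast, mul_inv_cancel₀ (by positivity),
      one_mul]
  have hlarge : ∃ C₁, ∀ x : ℝ, 1 ≤ x →
      x ^ k * ‖iteratedDeriv k (mellinInv 1 fun u ↦ H₁ u * u⁻¹) x‖ ≤ C₁ * x ^ (-A) := by
    obtain ⟨C₁, hC₁, hbound⟩ := exists_norm_mellinInv_le (A + 1)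
      fun u ↦ (∏ j ∈ Finset.range k, (-u - j)) * (H₁ u * u⁻¹)
    refine ⟨C₁, fun x hx ↦ ?_⟩
    have hx0 : 0 < x := by linarith
    rw [hnorm x hx0, mellinInv_eq_of_rapidDecayOn (b := A + 1) (by linarith) _
      ((hGdecay _).prod_neg_sub_mul (Metric.isBounded_Icc _ _) (fun j ↦ (j : ℂ)) k) hx0]
    · refine (hbound x hx0).trans ?_
      gcongr
      linarith
    · exact DifferentiableOn.mul (by fun_prop) (hGdiff _)
  obtain ⟨C₁, hC₁⟩ := hlarge
  have hshift : ∀ (m : ℕ) (a x : ℝ), -(1/4) ≤ a → a ≤ 1 → 0 < x →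
      mellinInv 1 (fun u ↦ (∏ j ∈ Finset.range (m + 1), (-u - j)) * (H₁ u * u⁻¹)) x =
      mellinInv a (fun u ↦ (∏ j ∈ Finset.range m, (-u - (j + 1 : ℕ))) * -H₁ u) x := by
    intro m a x ha ha1 hx
    have hneg : RapidDecayOn (fun u ↦ -H₁ u) (Set.Icc a 1) := fun n ↦ by
      simpa using hdecay' a 1 ha n
    rw [mellinInv_eq_of_rapidDecayOn ha1 _
      (hneg.prod_neg_sub_mul (Metric.isBounded_Icc _ _) (fun j ↦ ((j + 1 : ℕ) : ℂ)) m) hx]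
    · refine mellinInv_congr (fun u hu ↦ ?_) x
      have hu0 : u ≠ 0 := by
        rintro rfl
        simp at hu
      rw [Finset.prod_range_succ']
      simp only [Nat.cast_zero, sub_zero]
      linear_combination (-(∏ j ∈ Finset.range m, (-u - (j + 1 : ℕ))) * H₁ u) *
        mul_inv_cancel₀ hu0
    · exact DifferentiableOn.mul (by fun_prop) (hdiff a 1 ha).neg
  suffices ∃ C₀, ∀ x : ℝ, 0 < x → x ≤ 1 →
      x ^ k * ‖iteratedDeriv k (mellinInv 1 fun u ↦ H₁ u * u⁻¹) x‖ ≤ C₀ by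
    obtain ⟨C₀, hC₀⟩ := this
    exact exists_bound_one_add_rpow_neg hA.le hC₀ hC₁
  cases k with
  | zero =>
    obtain ⟨C, hC, hbound⟩ := exists_norm_mellinInv_le (-(1 / 4)) fun u ↦ -H₁ u
    refine ⟨‖mellinInv 1 (fun u ↦ H₁ u * u⁻¹) 1‖ + 4 * C, fun x hx hx1 ↦ ?_⟩
    simp only [pow_zero, one_mul, iteratedDeriv_zero]
    refine norm_le_of_norm_deriv_le_rpow hC (fun y hy ↦ hasDerivAt_mellinInv hGc hG1 hy)
      (fun y hy ↦ ?_) hx hx1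
    have h := hshift 0 (-(1 / 4)) y (by norm_num) (by norm_num) hy
    simp only [zero_add, Finset.prod_range_one, Nat.cast_zero, sub_zero, Finset.prod_range_zero,
      one_mul] at h
    rw [h, norm_mul, norm_inv, Complex.norm_of_nonneg hy.le]
    calc y⁻¹ * _ ≤ y⁻¹ * (C * y ^ (-(-(1 / 4)) : ℝ)) := by gcongr; exact hbound y hy
      _ = C * (y ^ (-1 : ℝ) * y ^ (-(-(1 / 4)) : ℝ)) := by rw [Real.rpow_neg_one]; ring
      _ = C * y ^ (-(3 / 4) : ℝ) := by rw [← Real.rpow_add hy]; norm_num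
  | succ m =>
    obtain ⟨C, hC, hbound⟩ := exists_norm_mellinInv_le 0
      fun u ↦ (∏ j ∈ Finset.range m, (-u - (j + 1 : ℕ))) * -H₁ u
    refine ⟨C, fun x hx hx1 ↦ ?_⟩
    rw [hnorm x hx, hshift m 0 x (by norm_num) zero_le_one hx]
    simpa using hbound x hx
end

section
/- Let (C_j)_{j≥0} be positive constants. There is a constant C > 0 (depending only on (C_j)) such that for every K ≥ 1, every admissible weight w of level K with constants (C_j), every a ∈ {0, 2}, and every x > 0: |4·Σ_{k ≥ 1, k ≡ a (mod 4)} w(k−1)·J_{k−1}(x) − w(x) + i^{a}·g(x)| ≤ C·x/K³, where g(x) = x^{−1/2}·Im(e^{ix − iπ/4}·w̌(1/(2x))) and w̌(v) = ∫_{0}^{∞} (w(√u)/√(2πu))·e^{iuv} du, with i⁰ = 1 and i² = −1. Moreover, for every integer j ≥ 0 there is a constant C'_j (depending only on j and (C_j)) such that |g(x)| ≤ C'_j·(x·K^{−2})^{j} for all x > 0. -/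
open Complex Real MeasureTheory Set

noncomputable def e (x : ℝ) : ℂ := Complex.exp (2 * Real.pi * Complex.I * x)

noncomputable def besselJ (n : ℕ) (x : ℝ) : ℂ :=
  ∫ t in (-(1:ℝ)/2)..(1/2), e (n * t) * Complex.exp (-(Complex.I * x * Real.sin (2 * Real.pi * t)))

def Admissible (K : ℝ) (C : ℕ → ℝ) (w : ℝ → ℝ) : Prop :=
  ContDiff ℝ (⊤ : ℕ∞) w ∧ tsupport w ⊆ Set.Icc K (2 * K) ∧
    ∀ (j : ℕ) (x : ℝ), |iteratedDeriv j w x| ≤ C j * K ^ (-(j : ℤ))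

noncomputable def Ssum (w : ℝ → ℝ) (α β : ℝ) : ℂ :=
  ∑' k : ℕ, if Odd k then
    Complex.I ^ k * besselJ k (4 * Real.pi * α) * besselJ (2 * k - 1) (4 * Real.pi * β) * (w k : ℂ)
  else 0


noncomputable def wcheck (w : ℝ → ℝ) (v : ℝ) : ℂ :=
  ∫ u in Set.Ioi (0:ℝ), ((w (Real.sqrt u) / Real.sqrt (2 * Real.pi * u) : ℝ) : ℂ) *
    Complex.exp (Complex.I * u * v)

noncomputable def gfun (w : ℝ → ℝ) (x : ℝ) : ℝ :=
  (Real.sqrt x)⁻¹ *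
    (Complex.exp (Complex.I * x - Complex.I * Real.pi / 4) * wcheck w (1 / (2 * x))).im


open scoped FourierTransform SchwartzMap ContDiff ComplexConjugate

theorem SchwartzMap.integral_mul_periodic (f : 𝓢(ℝ, ℂ)) {F : ℝ → ℂ} (hF : Continuous F)
    (hper : Function.Periodic F 1) (s : Finset ℤ) (hs : ∀ n : ℤ, n ∉ s → 𝓕 f (n : ℝ) = 0) :
    ∫ t, f t * F t = ∑ n ∈ s, 𝓕 f (n : ℝ) *
      ∫ t in (-(1:ℝ)/2)..(1/2), Complex.exp (2 * π * Complex.I * (n * t)) * F t := by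
  let h : C(ℝ, ℂ) := ⟨fun t => f t * F t, f.continuous.mul hF⟩
  obtain ⟨B, hB⟩ : ∃ B, ∀ t, ‖F t‖ ≤ B := by
    obtain ⟨B, hB⟩ := (isCompact_Icc (a := (0:ℝ)) (b := 1)).exists_bound_of_continuousOn
      hF.continuousOn
    refine ⟨B, fun t => ?_⟩
    obtain ⟨y, hy, hy'⟩ := hper.exists_mem_Ico₀ one_pos t
    rw [hy']
    exact hB y (Ico_subset_Icc_self hy)
  have hint : Integrable (fun t => f t * F t) :=
    f.integrable.mul_bdd hF.aestronglyMeasurable (Filter.Eventually.of_forall hB)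
  have hdecay : (h : ℝ → ℂ) =O[Filter.cocompact ℝ] fun x : ℝ => |x| ^ (-2 : ℝ) := by
    have h1 : (h : ℝ → ℂ) =O[Filter.cocompact ℝ] f := by
      refine Asymptotics.isBigO_of_le' (c := B) _ fun t => ?_
      change ‖f t * F t‖ ≤ _
      rw [norm_mul, mul_comm]
      exact mul_le_mul_of_nonneg_right (hB t) (norm_nonneg _)
    exact h1.trans (f.isBigO_cocompact_rpow (-2))
  have hsum := intervalIntegral.hasSum_intervalIntegral_of_summable_norm (a := -(1:ℝ)/2) (b := 1/2)
    (f := fun n : ℤ => h.comp (ContinuousMap.addRight (n : ℝ)))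
    (summable_of_isBigO (Real.summable_abs_int_rpow one_lt_two)
      ((isBigO_norm_restrict_cocompact h two_pos hdecay _).comp_tendsto
        Int.tendsto_coe_cofinite))
  have hsum' : HasSum (fun n : ℤ => ∫ t in (-(1:ℝ)/2)..(1/2),
      (h.comp (ContinuousMap.addRight (n : ℝ))) t) (∫ t, f t * F t) := by
    convert! hint.hasSum_intervalIntegral (-(1:ℝ)/2) using 2 with n
    have := intervalIntegral.integral_comp_add_right (a := -(1:ℝ)/2) (b := 1/2)
      (fun t => f t * F t) (n : ℝ)
    rw [show -(1:ℝ)/2 + n + 1 = 1/2 + n by ring, ← this]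
    rfl
  rw [hsum'.unique hsum]
  have hpoint : ∀ t : ℝ, ∑' n : ℤ, (h.comp (ContinuousMap.addRight (n : ℝ))) t =
      ∑ n ∈ s, 𝓕 f (n : ℝ) * (Complex.exp (2 * π * Complex.I * (n * t)) * F t) := by
    intro t
    have h1 : ∀ n : ℤ, (h.comp (ContinuousMap.addRight (n : ℝ))) t = f (t + n) * F t := by
      intro n
      change f (t + n) * F (t + n) = _
      have := hper.int_mul n t
      rw [mul_one] at this
      rw [this]
    simp_rw [h1]
    rw [tsum_mul_right, f.tsum_eq_tsum_fourier t, tsum_eq_sum (s := s), Finset.sum_mul]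
    · refine Finset.sum_congr rfl fun n _ => ?_
      rw [fourier_coe_apply, mul_assoc]
      congr 3
      push_cast
      ring
    · intro n hn
      rw [hs n hn, zero_mul]
  simp_rw [hpoint]
  rw [intervalIntegral.integral_finsetSum]
  · simp_rw [intervalIntegral.integral_const_mul]
  · intro n _
    apply Continuous.intervalIntegrable
    fun_prop

namespace Admissible

variable {K : ℝ} {C : ℕ → ℝ} {w : ℝ → ℝ}

theorem hasCompactSupport (hw : Admissible K C w) : HasCompactSupport w :=
  isCompact_Icc.of_isClosed_subset (isClosed_tsupport w) hw.2.1

theorem eq_zero (hw : Admissible K C w) {y : ℝ} (hy : y ∉ Icc K (2 * K)) : w y = 0 :=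
  image_eq_zero_of_notMem_tsupport fun h => hy (hw.2.1 h)

theorem eventuallyEq_zero (hw : Admissible K C w) {y : ℝ} (hy : y ∉ Icc K (2 * K)) :
    w =ᶠ[nhds y] 0 :=
  notMem_tsupport_iff_eventuallyEq.mp fun h => hy (hw.2.1 h)

/-- An admissible weight, as a complex-valued Schwartz function. -/
noncomputable def toSchwartz (hw : Admissible K C w) : 𝓢(ℝ, ℂ) :=
  HasCompactSupport.toSchwartzMap (f := fun y => (w y : ℂ))
    (hw.hasCompactSupport.comp_left Complex.ofReal_zero)
    (Complex.ofRealCLM.contDiff.comp hw.1)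

@[simp]
theorem toSchwartz_apply (hw : Admissible K C w) (y : ℝ) : hw.toSchwartz y = (w y : ℂ) := rfl

theorem norm_integral_le (hw : Admissible K C w) (hK : 0 ≤ K) {φ : ℝ → ℂ}
    (hφ : ∀ y, ‖φ y‖ ≤ 1) : ‖∫ y, (w y : ℂ) * φ y‖ ≤ C 0 * K := by
  rw [← setIntegral_eq_integral_of_forall_compl_eq_zero (s := Icc K (2 * K))
    (fun y hy => by rw [hw.eq_zero hy]; simp)]
  refine (norm_setIntegral_le_of_norm_le_const (C := C 0) (by simp) fun y _ => ?_).trans_eq ?_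
  · have h := hw.2.2 0 y
    simp only [iteratedDeriv_zero, CharP.cast_eq_zero, neg_zero, zpow_zero, mul_one] at h
    rw [norm_mul, norm_real, Real.norm_eq_abs]
    exact (mul_le_of_le_one_right (abs_nonneg _) (hφ y)).trans h
  · rw [Measure.real, Real.volume_Icc, ENNReal.toReal_ofReal (by linarith)]
    ring

/-- The derivative of an admissible weight is admissible after rescaling. -/
theorem deriv (hw : Admissible K C w) (hK : 0 < K) :
    Admissible K (fun j => C (j + 1)) (fun y => K * deriv w y) := by
  have hsmooth : ContDiff ℝ ∞ (_root_.deriv w) := (contDiff_infty_iff_deriv.mp hw.1).2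
  refine ⟨contDiff_const.mul hsmooth, ?_, fun j x => ?_⟩
  · exact ((tsupport_mul_subset_right (f := fun _ => K)).trans
      (closure_minimal (support_deriv_subset) (isClosed_tsupport w))).trans hw.2.1
  · rw [iteratedDeriv_const_mul_field, ← iteratedDeriv_succ', abs_mul, abs_of_pos hK]
    calc K * |iteratedDeriv (j + 1) w x| ≤ K * (C (j + 1) * K ^ (-((j + 1 : ℕ) : ℤ))) := by
          gcongr; exact hw.2.2 _ _
      _ = C (j + 1) * K ^ (-(j : ℤ)) := by
          have : K ^ (-(j : ℤ)) = K ^ (-((j + 1 : ℕ) : ℤ)) * K := by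
            rw [← zpow_add_one₀ hK.ne']; congr 1; push_cast; ring
          rw [this]; ring

theorem norm_fourier_le (hw : Admissible K C w) (hK : 0 < K) (m : ℕ) (t : ℝ) :
    |t| ^ m * ‖𝓕 hw.toSchwartz t‖ ≤ C m * K * K ^ (-(m : ℤ)) := by
  induction m generalizing C w with
  | zero =>
    have : 𝓕 hw.toSchwartz t =
        ∫ y, (w y : ℂ) * Complex.exp ((-2 * π * y * t : ℝ) * Complex.I) := by
      rw [SchwartzMap.fourier_coe, Real.fourier_real_eq_integral_exp_smul]
      simp only [toSchwartz_apply, smul_eq_mul, mul_comm]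
    rw [this]
    simpa using hw.norm_integral_le hK.le fun y =>
      (Complex.norm_exp_ofReal_mul_I (-2 * π * y * t)).le
  | succ m ih =>
    have hd := ih (hw.deriv hK)
    have h1 : 𝓕 (hw.deriv hK).toSchwartz t = K * ((2 * π * Complex.I * t) * 𝓕 hw.toSchwartz t) := by
      have h2 : ((hw.deriv hK).toSchwartz : ℝ → ℂ) =
          (K : ℂ) • _root_.deriv (hw.toSchwartz : ℝ → ℂ) := by
        ext y
        have : HasDerivAt (hw.toSchwartz : ℝ → ℂ) ((_root_.deriv w y : ℝ) : ℂ) y :=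
          ((hw.1.differentiable (by simp)) y).hasDerivAt.ofReal_comp
        simp [this.deriv]
      rw [SchwartzMap.fourier_coe, SchwartzMap.fourier_coe, h2]
      have h3 := congrFun (Real.fourier_deriv hw.toSchwartz.integrable
        hw.toSchwartz.differentiable (SchwartzMap.derivCLM ℝ ℂ hw.toSchwartz).integrable) t
      have h4 : 𝓕 ((K : ℂ) • _root_.deriv (hw.toSchwartz : ℝ → ℂ)) =
          (K : ℂ) • 𝓕 (_root_.deriv (hw.toSchwartz : ℝ → ℂ)) :=
        VectorFourier.fourierIntegral_const_smul _ _ _ _ _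
      rw [h4, Pi.smul_apply, h3]
      simp
    rw [h1] at hd
    have h5 : |t| ^ (m + 1) * ‖𝓕 hw.toSchwartz t‖ * (2 * π * K) ≤
        C (m + 1) * K * K ^ (-(m : ℤ)) := by
      refine le_of_eq_of_le ?_ hd
      simp only [norm_mul, norm_real, Complex.norm_I, Complex.norm_ofNat, Real.norm_eq_abs,
        abs_of_pos hK, abs_of_pos Real.pi_pos]
      ring
    have h6 : K ^ (-(m : ℤ)) = K ^ (-((m + 1 : ℕ) : ℤ)) * K := by
      rw [← zpow_add_one₀ hK.ne']; congr 1; push_cast; ring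
    rw [h6] at h5
    have h7 : |t| ^ (m + 1) * ‖𝓕 hw.toSchwartz t‖ * K ≤
        |t| ^ (m + 1) * ‖𝓕 hw.toSchwartz t‖ * (2 * π * K) := by
      gcongr
      nlinarith [Real.pi_gt_three]
    exact le_of_mul_le_mul_right (h7.trans (h5.trans_eq (by ring))) hK

end Admissible

namespace Admissible

variable {K : ℝ} {C : ℕ → ℝ} {w : ℝ → ℝ}

/-- The inverse Fourier transform of an admissible weight. -/
noncomputable def dual (hw : Admissible K C w) : 𝓢(ℝ, ℂ) := 𝓕⁻ hw.toSchwartz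

theorem fourier_dual (hw : Admissible K C w) : 𝓕 hw.dual = hw.toSchwartz :=
  FourierTransform.fourier_fourierInv_eq _

theorem dual_apply (hw : Admissible K C w) (t : ℝ) : hw.dual t = 𝓕 hw.toSchwartz (-t) := by
  rw [dual, SchwartzMap.fourierInv_coe, Real.fourierInv_eq_fourier_neg, SchwartzMap.fourier_coe]

theorem conj_dual (hw : Admissible K C w) (t : ℝ) : conj (hw.dual t) = hw.dual (-t) := by
  rw [dual_apply, dual_apply, SchwartzMap.fourier_coe,
    Real.fourier_real_eq_integral_exp_smul, Real.fourier_real_eq_integral_exp_smul,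
    ← integral_conj]
  congr 1 with y
  simp [← Complex.exp_conj, Complex.conj_ofNat]

theorem integral_dual_mul_exp (hw : Admissible K C w) (x : ℝ) :
    ∫ t, hw.dual t * Complex.exp (-(Complex.I * x * (2 * π * t : ℝ))) = w x := by
  rw [← hw.toSchwartz_apply, ← hw.fourier_dual, SchwartzMap.fourier_coe,
    Real.fourier_real_eq_integral_exp_smul]
  congr 1 with t
  rw [smul_eq_mul, mul_comm]
  congr 2
  push_cast
  ring

theorem cube_mul_norm_dual_le (hw : Admissible K C w) (hK : 0 < K) (t : ℝ) :
    |t| ^ 3 * ‖hw.dual t‖ ≤ (C 3 + C 5) / K ^ 2 * (1 + (K * t) ^ 2)⁻¹ := by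
  have h3 := hw.norm_fourier_le hK 3 (-t)
  have h5 := hw.norm_fourier_le hK 5 (-t)
  rw [abs_neg, ← dual_apply] at h3 h5
  have e3 : C 3 * K * K ^ (-((3 : ℕ) : ℤ)) = C 3 / K ^ 2 := by
    rw [zpow_neg, zpow_natCast]; field_simp
  have e5 : C 5 * K * K ^ (-((5 : ℕ) : ℤ)) = C 5 / K ^ 4 := by
    rw [zpow_neg, zpow_natCast]; field_simp
  rw [e3] at h3
  rw [e5] at h5
  rw [← div_eq_mul_inv, le_div_iff₀ (by positivity)]
  calc |t| ^ 3 * ‖hw.dual t‖ * (1 + (K * t) ^ 2)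
      = |t| ^ 3 * ‖hw.dual t‖ + K ^ 2 * (|t| ^ 5 * ‖hw.dual t‖) := by
        rw [mul_pow, ← sq_abs t]; ring
    _ ≤ C 3 / K ^ 2 + K ^ 2 * (C 5 / K ^ 4) := by gcongr
    _ = (C 3 + C 5) / K ^ 2 := by field_simp

theorem norm_integral_dual_mul_le (hw : Admissible K C w) (hK : 0 < K) {φ : ℝ → ℂ} {A : ℝ}
    (hA : 0 ≤ A) (hφ : ∀ t, ‖φ t‖ ≤ A * |t| ^ 3) :
    ‖∫ t, hw.dual t * φ t‖ ≤ A * ((C 3 + C 5) * π) / K ^ 3 := by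
  have hint : Integrable fun t : ℝ => (1 + (K * t) ^ 2)⁻¹ :=
    (integrable_inv_one_add_sq).comp_mul_left' hK.ne'
  refine (norm_integral_le_of_norm_le (hint.const_mul (A * ((C 3 + C 5) / K ^ 2)))
    (Filter.Eventually.of_forall fun t => ?_)).trans_eq ?_
  · rw [norm_mul, mul_assoc]
    calc ‖hw.dual t‖ * ‖φ t‖ ≤ ‖hw.dual t‖ * (A * |t| ^ 3) := by gcongr; exact hφ t
      _ = A * (|t| ^ 3 * ‖hw.dual t‖) := by ring
      _ ≤ _ := mul_le_mul_of_nonneg_left (hw.cube_mul_norm_dual_le hK t) hA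
  · rw [integral_const_mul, Measure.integral_comp_mul_left (fun t => (1 + t ^ 2)⁻¹),
      integral_univ_inv_one_add_sq, abs_of_pos (inv_pos.mpr hK), smul_eq_mul]
    field_simp

theorem integral_dual_mul_gaussian (hw : Admissible K C w) {b : ℂ} (hb : 0 < b.re) :
    ∫ t : ℝ, hw.dual t * Complex.exp (-π * b * t ^ 2) =
      (1 / b ^ (1 / 2 : ℂ)) * ∫ y : ℝ, (w y : ℂ) * Complex.exp (-π / b * y ^ 2) := by
  have hg : Integrable fun t : ℝ => Complex.exp (-π * b * t ^ 2) := by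
    have := integrable_cexp_neg_mul_sq (b := π * b)
      (by rw [re_ofReal_mul]; exact mul_pos Real.pi_pos hb)
    simpa only [neg_mul] using this
  have h1 : ∫ t : ℝ, hw.dual t * Complex.exp (-π * b * t ^ 2) =
      ∫ t : ℝ, 𝓕 (hw.toSchwartz : ℝ → ℂ) t • Complex.exp (-π * b * t ^ 2) := by
    rw [← integral_neg_eq_self]
    congr 1 with t
    rw [dual_apply, neg_neg, SchwartzMap.fourier_coe, smul_eq_mul]
    simp
  rw [h1]
  have h2 := VectorFourier.integral_fourierIntegral_smul_eq_flip (μ := volume) (ν := volume)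
    (L := innerₗ ℝ) Real.continuous_fourierChar continuous_inner hw.toSchwartz.integrable hg
  rw [flip_innerₗ] at h2
  refine h2.trans ?_
  rw [← integral_const_mul]
  congr 1 with y
  have := congrFun (fourier_gaussian_pi hb) y
  change hw.toSchwartz y • (𝓕 (fun t : ℝ => Complex.exp (-π * b * t ^ 2)) : ℝ → ℂ) y = _
  rw [this, smul_eq_mul, toSchwartz_apply]
  ring

end Admissible

theorem Complex.cpow_one_half_ofReal_mul_I {r : ℝ} (hr : 0 < r) :
    ((r : ℂ) * Complex.I) ^ (1 / 2 : ℂ) = Real.sqrt r * Complex.exp (Complex.I * π / 4) := by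
  have hrI : (r : ℂ) * Complex.I ≠ 0 := mul_ne_zero (ofReal_ne_zero.mpr hr.ne') Complex.I_ne_zero
  rw [cpow_def_of_ne_zero hrI, Complex.log_ofReal_mul hr Complex.I_ne_zero, Complex.log_I,
    add_mul, Complex.exp_add, Real.sqrt_eq_rpow, Real.rpow_def_of_pos hr]
  congr 1
  · push_cast; rfl
  · congr 1; ring

theorem wcheck_eq {w : ℝ → ℝ} (hw : ∀ y ≤ 0, w y = 0) (v : ℝ) :
    wcheck w v = 2 / Real.sqrt (2 * π) * ∫ y, (w y : ℂ) * Complex.exp (Complex.I * y ^ 2 * v) := by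
  have hsupp := setIntegral_eq_integral_of_forall_compl_eq_zero (μ := volume) (s := Ioi (0 : ℝ))
    (f := fun y => 2 / Real.sqrt (2 * π) * ((w y : ℂ) * Complex.exp (Complex.I * y ^ 2 * v)))
    (fun y hy => by rw [hw y (not_lt.mp hy)]; simp)
  rw [wcheck, ← integral_comp_rpow_Ioi_of_pos two_pos, ← integral_const_mul, ← hsupp]
  refine setIntegral_congr_fun measurableSet_Ioi fun y (hy : 0 < y) => ?_
  have h1 : y ^ ((2 : ℝ) - 1) = y := by norm_num
  have h2 : Real.sqrt (2 * π * y ^ 2) = Real.sqrt (2 * π) * y := by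
    rw [Real.sqrt_mul (by positivity), Real.sqrt_sq hy.le]
  have hy' : (y : ℂ) ≠ 0 := ofReal_ne_zero.mpr hy.ne'
  have hpi : (Real.sqrt (2 * π) : ℂ) ≠ 0 :=
    ofReal_ne_zero.mpr (Real.sqrt_pos.mpr (by positivity)).ne'
  simp only [h1, Real.rpow_two, h2, Real.sqrt_sq hy.le, Complex.real_smul]
  push_cast
  field_simp

namespace Admissible

variable {K : ℝ} {C : ℕ → ℝ} {w : ℝ → ℝ}

theorem tendsto_integral_dual_gaussian (hw : Admissible K C w) (z : ℂ) (hz : 0 ≤ z.re) :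
    Filter.Tendsto (fun ε : ℝ => ∫ t : ℝ, hw.dual t * Complex.exp (-π * (ε + z) * t ^ 2))
      (nhdsWithin 0 (Ioi 0)) (nhds (∫ t : ℝ, hw.dual t * Complex.exp (-π * z * t ^ 2))) := by
  refine tendsto_integral_filter_of_dominated_convergence (fun t => ‖hw.dual t‖) ?_ ?_
    hw.dual.integrable.norm ?_
  · filter_upwards with ε
    exact (hw.dual.continuous.mul (by fun_prop)).aestronglyMeasurable
  · filter_upwards [self_mem_nhdsWithin] with ε (hε : 0 < ε)
    filter_upwards with t
    rw [norm_mul, Complex.norm_exp]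
    refine mul_le_of_le_one_right (norm_nonneg _) (Real.exp_le_one_iff.mpr ?_)
    have : (-π * (ε + z) * t ^ 2 : ℂ).re = -(π * (ε + z.re) * t ^ 2) := by
      rw [← ofReal_neg, ← ofReal_pow, re_mul_ofReal, re_ofReal_mul]
      simp
    rw [this, neg_nonpos]
    positivity
  · filter_upwards with t
    have : Continuous fun ε : ℝ => hw.dual t * Complex.exp (-π * (ε + z) * t ^ 2) := by fun_prop
    simpa using (this.tendsto 0).mono_left nhdsWithin_le_nhds

theorem tendsto_integral_gaussian (hw : Admissible K C w) (z : ℂ) (hz : 0 ≤ z.re) (hz0 : z ≠ 0) :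
    Filter.Tendsto (fun ε : ℝ => ∫ y : ℝ, (w y : ℂ) * Complex.exp (-π / (ε + z) * y ^ 2))
      (nhdsWithin 0 (Ioi 0)) (nhds (∫ y : ℝ, (w y : ℂ) * Complex.exp (-π / z * y ^ 2))) := by
  refine tendsto_integral_filter_of_dominated_convergence (fun y => ‖hw.toSchwartz y‖) ?_ ?_
    hw.toSchwartz.integrable.norm ?_
  · filter_upwards with ε
    exact (hw.toSchwartz.continuous.mul (by fun_prop)).aestronglyMeasurable
  · filter_upwards [self_mem_nhdsWithin] with ε (hε : 0 < ε)
    filter_upwards with y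
    rw [norm_mul, Complex.norm_exp]
    refine mul_le_of_le_one_right (norm_nonneg _) (Real.exp_le_one_iff.mpr ?_)
    have : (-π / (ε + z) * y ^ 2 : ℂ).re =
        -(π * ((ε + z.re) / Complex.normSq (ε + z)) * y ^ 2) := by
      rw [← ofReal_neg, ← ofReal_pow, re_mul_ofReal, div_eq_mul_inv, re_ofReal_mul, Complex.inv_re]
      simp
    rw [this, neg_nonpos]
    have := Complex.normSq_nonneg (ε + z)
    positivity
  · filter_upwards with y
    have : ContinuousAt (fun ε : ℝ => (w y : ℂ) * Complex.exp (-π / (ε + z) * y ^ 2)) 0 := by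
      have : ((0 : ℝ) : ℂ) + z ≠ 0 := by simpa using hz0
      fun_prop (disch := assumption)
    simpa using this.tendsto.mono_left nhdsWithin_le_nhds

/-- The Fresnel integral: Parseval's identity against an imaginary Gaussian. -/
theorem integral_dual_mul_fresnel (hw : Admissible K C w) {r : ℝ} (hr : 0 < r) :
    ∫ t : ℝ, hw.dual t * Complex.exp (-π * (r * Complex.I) * t ^ 2) =
      (1 / (r * Complex.I) ^ (1 / 2 : ℂ)) *
        ∫ y : ℝ, (w y : ℂ) * Complex.exp (-π / (r * Complex.I) * y ^ 2) := by
  have hre : ((r : ℂ) * Complex.I).re = 0 := by simp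
  have hne : (r : ℂ) * Complex.I ≠ 0 := mul_ne_zero (ofReal_ne_zero.mpr hr.ne') Complex.I_ne_zero
  refine tendsto_nhds_unique (hw.tendsto_integral_dual_gaussian _ hre.ge) ?_
  have hcoef : Filter.Tendsto (fun ε : ℝ => 1 / ((ε : ℂ) + r * Complex.I) ^ (1 / 2 : ℂ))
      (nhdsWithin 0 (Ioi 0)) (nhds (1 / ((r : ℂ) * Complex.I) ^ (1 / 2 : ℂ))) := by
    have h1 : ContinuousAt (fun ε : ℝ => (ε : ℂ) + r * Complex.I) 0 := by fun_prop
    have h2 : ContinuousAt (fun ε : ℝ => 1 / ((ε : ℂ) + r * Complex.I) ^ (1 / 2 : ℂ)) 0 := by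
      refine continuousAt_const.div (h1.cpow continuousAt_const ?_) ?_
      · right; simpa using hr.ne'
      · rw [ofReal_zero, zero_add, Complex.cpow_one_half_ofReal_mul_I hr]
        exact mul_ne_zero (ofReal_ne_zero.mpr (Real.sqrt_pos.mpr hr).ne') (Complex.exp_ne_zero _)
    simpa using h2.tendsto.mono_left nhdsWithin_le_nhds
  refine (hcoef.mul (hw.tendsto_integral_gaussian _ hre.ge hne)).congr' ?_
  filter_upwards [self_mem_nhdsWithin] with ε (hε : 0 < ε)
  exact (hw.integral_dual_mul_gaussian (by simpa using hε)).symm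

theorem integral_dual_mul_exp_quadratic (hw : Admissible K C w) (hK : 0 < K) {x : ℝ}
    (hx : 0 < x) :
    ∫ t : ℝ, hw.dual t * Complex.exp (Complex.I * x * (1 - (2 * π * t) ^ 2 / 2 : ℝ)) =
      ((Real.sqrt x)⁻¹ : ℝ) * (Complex.exp (Complex.I * x - Complex.I * π / 4) *
        wcheck w (1 / (2 * x))) / 2 := by
  have h1 := hw.integral_dual_mul_fresnel (r := 2 * π * x) (by positivity)
  have h2 : ∀ t : ℝ, hw.dual t * Complex.exp (Complex.I * x * (1 - (2 * π * t) ^ 2 / 2 : ℝ)) =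
      Complex.exp (Complex.I * x) *
        (hw.dual t * Complex.exp (-π * ((2 * π * x : ℝ) * Complex.I) * t ^ 2)) := by
    intro t
    rw [mul_left_comm, ← Complex.exp_add]
    congr 2
    push_cast
    ring
  have hxc : (x : ℂ) ≠ 0 := ofReal_ne_zero.mpr hx.ne'
  have hpc : (π : ℂ) ≠ 0 := ofReal_ne_zero.mpr Real.pi_ne_zero
  have h3 : ∀ y : ℝ, (w y : ℂ) * Complex.exp (-π / ((2 * π * x : ℝ) * Complex.I) * y ^ 2) =
      (w y : ℂ) * Complex.exp (Complex.I * y ^ 2 * (1 / (2 * x) : ℝ)) := by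
    intro y
    congr 2
    push_cast
    have hI := Complex.I_ne_zero
    field_simp
    rw [Complex.I_sq, neg_one_mul]
  simp_rw [h2, integral_const_mul, h1, h3]
  rw [wcheck_eq (fun y hy => hw.eq_zero fun h => (hK.trans_le h.1).not_ge hy),
    Complex.cpow_one_half_ofReal_mul_I (by positivity), Complex.exp_sub,
    Real.sqrt_mul (by positivity) x]
  push_cast
  have hs1 : (Real.sqrt (2 * π) : ℂ) ≠ 0 :=
    ofReal_ne_zero.mpr (Real.sqrt_pos.mpr (by positivity)).ne'
  have hs2 : (Real.sqrt x : ℂ) ≠ 0 := ofReal_ne_zero.mpr (Real.sqrt_pos.mpr hx).ne'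
  have he := Complex.exp_ne_zero (Complex.I * π / 4)
  field_simp

theorem gfun_eq_integral (hw : Admissible K C w) (hK : 0 < K) {x : ℝ} (hx : 0 < x) :
    gfun w x = 2 * (∫ t : ℝ,
      hw.dual t * Complex.exp (Complex.I * x * (1 - (2 * π * t) ^ 2 / 2 : ℝ))).im := by
  rw [hw.integral_dual_mul_exp_quadratic hK hx, gfun, Complex.div_ofNat_im,
    Complex.im_ofReal_mul]
  ring

end Admissible

theorem iteratedDeriv_succ_id_mul {h : ℝ → ℝ} (hh : ContDiff ℝ ∞ h) (j : ℕ) (y : ℝ) :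
    iteratedDeriv (j + 1) (fun y => y * h y) y =
      y * iteratedDeriv (j + 1) h y + (j + 1) * iteratedDeriv j h y := by
  have hd : ∀ i, Differentiable ℝ (iteratedDeriv i h) := fun i =>
    hh.differentiable_iteratedDeriv i (by exact_mod_cast WithTop.coe_lt_top i)
  induction j generalizing y with
  | zero =>
    rw [zero_add, iteratedDeriv_one, iteratedDeriv_one, iteratedDeriv_zero]
    have := (hasDerivAt_id y).mul ((hh.differentiable (by simp)) y).hasDerivAt
    refine this.deriv.trans ?_
    simp only [id]
    push_cast
    ring
  | succ j ih =>
    rw [iteratedDeriv_succ, funext ih]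
    have h1 := ((hasDerivAt_id y).mul (hd (j + 1) y).hasDerivAt).add
      (((hd j) y).hasDerivAt.const_mul ((j : ℝ) + 1))
    refine h1.deriv.trans ?_
    rw [← iteratedDeriv_succ, ← iteratedDeriv_succ]
    simp only [id]
    push_cast
    ring

/-- Constants for the weight obtained from an admissible weight by dividing by the variable. -/
def divIdConst (C : ℕ → ℝ) : ℕ → ℝ
  | 0 => C 0
  | j + 1 => C (j + 1) + (j + 1) * divIdConst C j

namespace Admissible

variable {K : ℝ} {C : ℕ → ℝ} {w : ℝ → ℝ}

theorem contDiff_div_id (hw : Admissible K C w) (hK : 0 < K) :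
    ContDiff ℝ ∞ fun y => w y / y := by
  refine contDiff_iff_contDiffAt.mpr fun y => ?_
  by_cases hy : y ∈ Icc K (2 * K)
  · exact hw.1.contDiffAt.div contDiffAt_id (hK.trans_le hy.1).ne'
  · refine (contDiffAt_const (c := (0 : ℝ))).congr_of_eventuallyEq ?_
    filter_upwards [hw.eventuallyEq_zero hy] with z hz
    simp [hz]

theorem div_id (hw : Admissible K C w) (hK : 0 < K) :
    Admissible K (divIdConst C) fun y => K * (w y / y) := by
  have hsmooth := hw.contDiff_div_id hK
  refine ⟨contDiff_const.mul hsmooth, ?_, fun j y => ?_⟩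
  · refine (closure_mono fun y hy => ?_).trans hw.2.1
    contrapose! hy
    simp [Function.notMem_support.mp hy]
  rw [iteratedDeriv_const_mul_field, abs_mul, abs_of_pos hK]
  by_cases hy : y ∈ Icc K (2 * K)
  · have hbound : ∀ i : ℕ, K * |iteratedDeriv i (fun y => w y / y) y| ≤
        y * |iteratedDeriv i (fun y => w y / y) y| :=
      fun i => mul_le_mul_of_nonneg_right hy.1 (abs_nonneg _)
    have hypos : 0 < y := hK.trans_le hy.1
    induction j with
    | zero =>
      refine (hbound 0).trans ?_
      have h0 := hw.2.2 0 y
      rw [iteratedDeriv_zero] at h0 ⊢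
      rw [abs_div, abs_of_pos hypos, mul_div_cancel₀ _ hypos.ne']
      exact h0
    | succ j ih =>
      refine (hbound (j + 1)).trans ?_
      have hid : (fun y => y * (w y / y)) = w := by
        ext z
        rcases eq_or_ne z 0 with rfl | hz
        · rw [zero_mul, hw.eq_zero fun h => hK.not_ge h.1]
        · exact mul_div_cancel₀ _ hz
      have h1 := iteratedDeriv_succ_id_mul hsmooth j y
      rw [hid] at h1
      have h2 : y * |iteratedDeriv (j + 1) (fun y => w y / y) y| ≤
          |iteratedDeriv (j + 1) w y| + (j + 1) * |iteratedDeriv j (fun y => w y / y) y| := by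
        have h3 : y * iteratedDeriv (j + 1) (fun y => w y / y) y =
            iteratedDeriv (j + 1) w y - (j + 1) * iteratedDeriv j (fun y => w y / y) y := by
          linarith
        have h4 := congrArg abs h3
        rw [abs_mul, abs_of_pos hypos] at h4
        rw [h4]
        refine (abs_sub _ _).trans_eq ?_
        rw [abs_mul, abs_of_pos (by positivity : (0 : ℝ) < j + 1)]
      have hKpow : K ^ (-(j : ℤ)) = K ^ (-((j + 1 : ℕ) : ℤ)) * K := by
        rw [← zpow_add_one₀ hK.ne']; congr 1; push_cast; ring
      have h5 : |iteratedDeriv j (fun y => w y / y) y| ≤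
          divIdConst C j * K ^ (-((j + 1 : ℕ) : ℤ)) := by
        refine le_of_mul_le_mul_left (ih.trans_eq ?_) hK
        rw [hKpow]; ring
      calc y * |iteratedDeriv (j + 1) (fun y => w y / y) y|
          ≤ C (j + 1) * K ^ (-((j + 1 : ℕ) : ℤ)) +
            (j + 1) * (divIdConst C j * K ^ (-((j + 1 : ℕ) : ℤ))) := by
            refine h2.trans ?_
            gcongr
            exact hw.2.2 _ _
        _ = divIdConst C (j + 1) * K ^ (-((j + 1 : ℕ) : ℤ)) := by
            rw [divIdConst]; ring
  · have hz : (fun y => w y / y) =ᶠ[nhds y] fun _ => (0 : ℝ) := by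
      filter_upwards [hw.eventuallyEq_zero hy] with z hz
      simp [hz]
    have hnonneg : ∀ i, 0 ≤ divIdConst C i := by
      have hC : ∀ i, 0 ≤ C i := fun i =>
        nonneg_of_mul_nonneg_left ((abs_nonneg _).trans (hw.2.2 i 0)) (by positivity)
      intro i
      induction i with
      | zero => exact hC 0
      | succ i ih => exact add_nonneg (hC _) (by positivity)
    rw [hz.iteratedDeriv_eq]
    have := hnonneg j
    simp only [iteratedDeriv_const]
    split_ifs <;> simp <;> positivity

theorem integral_mul_exp_sq (hw : Admissible K C w) (hK : 0 < K) {v : ℝ} (hv : 0 < v) :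
    ∫ y, (w y : ℂ) * Complex.exp (Complex.I * y ^ 2 * v) =
      -(1 / (2 * Complex.I * v * K ^ 2)) *
        ∫ y, ((K * _root_.deriv (fun y => K * (w y / y)) y : ℝ) : ℂ) *
          Complex.exp (Complex.I * y ^ 2 * v) := by
  set u : ℝ → ℝ := fun y => K * (w y / y) with hu
  have hadm := hw.div_id hK
  have hvc : (v : ℂ) ≠ 0 := ofReal_ne_zero.mpr hv.ne'
  have hKc : (K : ℂ) ≠ 0 := ofReal_ne_zero.mpr hK.ne'
  have hE : ∀ y : ℝ, HasDerivAt (fun y : ℝ => Complex.exp (Complex.I * y ^ 2 * v))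
      (2 * Complex.I * v * y * Complex.exp (Complex.I * y ^ 2 * v)) y := by
    intro y
    have h1 : HasDerivAt (fun z : ℂ => Complex.exp (Complex.I * z ^ 2 * v))
        (2 * Complex.I * v * y * Complex.exp (Complex.I * y ^ 2 * v)) (y : ℂ) := by
      convert! ((((hasDerivAt_id (y : ℂ)).pow 2).const_mul Complex.I).mul_const (v : ℂ)).cexp
        using 1
      simp only [id, Pi.pow_apply]
      push_cast
      ring
    exact h1.comp_ofReal
  have hU : ∀ y : ℝ, HasDerivAt (fun y => (u y : ℂ)) ((_root_.deriv u y : ℝ) : ℂ) y := fun y =>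
    ((hadm.1.differentiable (by simp)) y).hasDerivAt.ofReal_comp
  have hcs := hadm.hasCompactSupport
  have hcu : Continuous u := hadm.1.continuous
  have hcu' : Continuous (_root_.deriv u) := hadm.1.continuous_deriv (by simp)
  have hcsu : HasCompactSupport fun y => (u y : ℂ) := hcs.comp_left Complex.ofReal_zero
  have hcsu' : HasCompactSupport fun y => ((_root_.deriv u y : ℝ) : ℂ) :=
    hcs.deriv.comp_left Complex.ofReal_zero
  have hcE : Continuous fun y : ℝ => Complex.exp (Complex.I * y ^ 2 * v) := by fun_prop
  have hcE' : Continuous fun y : ℝ =>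
      2 * Complex.I * v * y * Complex.exp (Complex.I * y ^ 2 * v) := by fun_prop
  have hcuc := Complex.continuous_ofReal.comp hcu
  have hparts := integral_mul_deriv_eq_deriv_mul_of_integrable (fun y _ => hU y) (fun y _ => hE y)
    ((hcuc.mul hcE').integrable_of_hasCompactSupport hcsu.mul_right)
    (((Complex.continuous_ofReal.comp hcu').mul hcE).integrable_of_hasCompactSupport
      hcsu'.mul_right)
    ((hcuc.mul hcE).integrable_of_hasCompactSupport hcsu.mul_right)
  have hleft : ∀ y : ℝ, (w y : ℂ) * Complex.exp (Complex.I * y ^ 2 * v) =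
      (1 / (2 * Complex.I * v * K)) *
        ((u y : ℂ) * (2 * Complex.I * v * y * Complex.exp (Complex.I * y ^ 2 * v))) := by
    intro y
    rcases eq_or_ne y 0 with rfl | hy
    · simp [hw.eq_zero fun h => hK.not_ge h.1]
    · have hyc : (y : ℂ) ≠ 0 := ofReal_ne_zero.mpr hy
      have hI := Complex.I_ne_zero
      simp only [hu]
      push_cast
      field_simp
  simp_rw [hleft, integral_const_mul, hparts]
  push_cast
  simp_rw [mul_assoc (K : ℂ), integral_const_mul]
  have hI := Complex.I_ne_zero
  field_simp

theorem exists_norm_integral_mul_exp_sq_le (C : ℕ → ℝ) (m : ℕ) :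
    ∃ D : ℝ, 0 ≤ D ∧ ∀ K : ℝ, 0 < K → ∀ w : ℝ → ℝ, Admissible K C w → ∀ v : ℝ, 0 < v →
      ‖∫ y, (w y : ℂ) * Complex.exp (Complex.I * y ^ 2 * v)‖ ≤ D * K / (K ^ 2 * v) ^ m := by
  induction m generalizing C with
  | zero =>
    refine ⟨|C 0|, abs_nonneg _, fun K hK w hw v _ => ?_⟩
    rw [pow_zero, div_one]
    refine (hw.norm_integral_le hK.le fun y => ?_).trans (by gcongr; exact le_abs_self _)
    rw [show Complex.I * y ^ 2 * v = ((y ^ 2 * v : ℝ) : ℂ) * Complex.I by push_cast; ring]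
    exact (Complex.norm_exp_ofReal_mul_I _).le
  | succ m ih =>
    obtain ⟨D, hD, h⟩ := ih fun j => divIdConst C (j + 1)
    refine ⟨D, hD, fun K hK w hw v hv => ?_⟩
    rw [hw.integral_mul_exp_sq hK hv, norm_mul]
    have h1 := h K hK _ ((hw.div_id hK).deriv hK) v hv
    have h2 : ‖-(1 / (2 * Complex.I * v * K ^ 2))‖ = 1 / (2 * (K ^ 2 * v)) := by
      rw [norm_neg, norm_div, norm_one]
      simp only [norm_mul, norm_pow, norm_real, Complex.norm_I, Complex.norm_ofNat,
        Real.norm_eq_abs, abs_of_pos hK, abs_of_pos hv]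
      ring
    rw [h2]
    have hpos : 0 < K ^ 2 * v := by positivity
    have h3 : 1 / (2 * (K ^ 2 * v)) ≤ 1 / (K ^ 2 * v) :=
      one_div_le_one_div_of_le hpos (by linarith)
    refine (mul_le_mul h3 h1 (norm_nonneg _) (by positivity)).trans_eq ?_
    rw [div_mul_div_comm, one_mul, pow_succ' (K ^ 2 * v) m]

theorem exists_abs_gfun_le (C : ℕ → ℝ) (m : ℕ) :
    ∃ D : ℝ, 0 ≤ D ∧ ∀ K : ℝ, 0 < K → ∀ w : ℝ → ℝ, Admissible K C w → ∀ x : ℝ, 0 < x →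
      |gfun w x| ≤ D * (x / K ^ 2) ^ m / Real.sqrt (x / K ^ 2) := by
  obtain ⟨D, hD, h⟩ := exists_norm_integral_mul_exp_sq_le C m
  refine ⟨D * 2 ^ m, by positivity, fun K hK w hw x hx => ?_⟩
  have h1 := h K hK w hw (1 / (2 * x)) (by positivity)
  have h2 : ‖wcheck w (1 / (2 * x))‖ ≤ D * K / (K ^ 2 * (1 / (2 * x))) ^ m := by
    rw [wcheck_eq (fun y hy => hw.eq_zero fun h => (hK.trans_le h.1).not_ge hy), norm_mul]
    refine (mul_le_of_le_one_left (norm_nonneg _) ?_).trans h1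
    rw [norm_div, Complex.norm_ofNat, norm_real, Real.norm_eq_abs,
      abs_of_nonneg (Real.sqrt_nonneg _), div_le_one (by positivity)]
    exact Real.le_sqrt_of_sq_le (by nlinarith [Real.pi_gt_three])
  have h3 : |gfun w x| ≤ (Real.sqrt x)⁻¹ * ‖wcheck w (1 / (2 * x))‖ := by
    rw [gfun, abs_mul, abs_of_nonneg (inv_nonneg.mpr (Real.sqrt_nonneg x))]
    gcongr
    refine (Complex.abs_im_le_norm _).trans_eq ?_
    rw [norm_mul, show Complex.I * x - Complex.I * π / 4 = ((x - π / 4 : ℝ) : ℂ) * Complex.I by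
      push_cast; ring, Complex.norm_exp_ofReal_mul_I, one_mul]
  refine h3.trans ((mul_le_mul_of_nonneg_left h2 (by positivity)).trans_eq ?_)
  rw [Real.sqrt_div' _ (sq_nonneg K), Real.sqrt_sq hK.le]
  have hs := Real.sqrt_pos.mpr hx
  rw [show K ^ 2 * (1 / (2 * x)) = (2 * (x / K ^ 2))⁻¹ by field_simp, inv_pow, mul_pow]
  field_simp

theorem exists_abs_gfun_le_pow (C : ℕ → ℝ) (j : ℕ) :
    ∃ D : ℝ, 0 < D ∧ ∀ K : ℝ, 0 < K → ∀ w : ℝ → ℝ, Admissible K C w → ∀ x : ℝ, 0 < x →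
      |gfun w x| ≤ D * (x / K ^ 2) ^ j := by
  obtain ⟨D, hD, h⟩ := exists_abs_gfun_le C 0
  obtain ⟨D', hD', h'⟩ := exists_abs_gfun_le C (j + 1)
  refine ⟨D + D' + 1, by positivity, fun K hK w hw x hx => ?_⟩
  set q := x / K ^ 2 with hq
  have hqpos : 0 < q := by positivity
  rcases le_total 1 q with hq1 | hq1
  · calc |gfun w x| ≤ D * q ^ 0 / Real.sqrt q := h K hK w hw x hx
      _ ≤ D := by
        rw [pow_zero, mul_one]
        exact div_le_self hD (Real.one_le_sqrt.mpr hq1)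
      _ ≤ (D + D' + 1) * 1 := by linarith
      _ ≤ (D + D' + 1) * q ^ j := by gcongr; exact one_le_pow₀ hq1
  · calc |gfun w x| ≤ D' * q ^ (j + 1) / Real.sqrt q := h' K hK w hw x hx
      _ = D' * q ^ j * Real.sqrt q := by
        rw [pow_succ, ← mul_assoc, mul_div_assoc, Real.div_sqrt]
      _ ≤ D' * q ^ j * 1 := by gcongr; exact Real.sqrt_le_one.mpr hq1
      _ ≤ (D + D' + 1) * q ^ j := by rw [mul_one]; gcongr; linarith

end Admissible

theorem Real.abs_sin_sub_self_le (θ : ℝ) : |Real.sin θ - θ| ≤ |θ| ^ 3 := by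
  have hθ := abs_nonneg θ
  rcases le_total |θ| 1 with h | h
  · have h1 := Real.sin_bound h
    have h2 : |Real.sin θ - θ| ≤ |Real.sin θ - (θ - θ ^ 3 / 6)| + |θ ^ 3 / 6| :=
      (congrArg abs (by ring)).trans_le (abs_sub (Real.sin θ - (θ - θ ^ 3 / 6)) (θ ^ 3 / 6))
    rw [abs_div, abs_pow, abs_of_pos (by norm_num : (0 : ℝ) < 6)] at h2
    have h3 : |θ| ^ 5 ≤ |θ| ^ 3 := pow_le_pow_of_le_one hθ h (by norm_num)
    linarith [pow_nonneg hθ 3]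
  · have h1 : |Real.sin θ - θ| ≤ 2 * |θ| := by
      refine (abs_sub _ _).trans ?_
      linarith [Real.abs_sin_le_one θ]
    rcases le_total 2 |θ| with h2 | h2
    · nlinarith [mul_nonneg hθ hθ]
    · rcases le_total 0 θ with hs | hs
      · rw [abs_of_nonneg hs] at *
        rw [abs_sub_comm, abs_of_nonneg (by linarith [Real.sin_le hs])]
        nlinarith [Real.sin_nonneg_of_nonneg_of_le_pi hs (by linarith [Real.pi_gt_three]),
          one_le_pow₀ h (n := 2)]
      · rw [abs_of_nonpos hs] at *
        rw [abs_of_nonneg (by linarith [Real.sin_le (neg_nonneg.mpr hs), Real.sin_neg θ])]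
        nlinarith [Real.sin_nonneg_of_nonneg_of_le_pi (neg_nonneg.mpr hs)
          (by linarith [Real.pi_gt_three]), Real.sin_neg θ, one_le_pow₀ h (n := 2)]

theorem Real.abs_cos_sub_quadratic_le (θ : ℝ) :
    |Real.cos θ - (1 - θ ^ 2 / 2)| ≤ |θ| ^ 3 := by
  have hθ := abs_nonneg θ
  rcases le_total |θ| 1 with h | h
  · have h3 : |θ| ^ 4 ≤ |θ| ^ 3 := pow_le_pow_of_le_one hθ h (by norm_num)
    linarith [Real.cos_bound h, pow_nonneg hθ 4]
  · rw [abs_of_nonneg (by linarith [Real.one_sub_sq_div_two_le_cos (x := θ)])]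
    have h3 : |θ| ^ 2 ≤ |θ| ^ 3 := pow_le_pow_right₀ h (by norm_num)
    rw [sq_abs] at h3
    nlinarith [Real.cos_le_one θ, sq_nonneg θ]

theorem Complex.norm_exp_I_mul_sub_exp_I_mul_le (x a b : ℝ) :
    ‖Complex.exp (Complex.I * x * a) - Complex.exp (Complex.I * x * b)‖ ≤ |x| * |a - b| := by
  have h : Complex.exp (Complex.I * x * a) - Complex.exp (Complex.I * x * b) =
      Complex.exp ((x * b : ℝ) * Complex.I) *
        (Complex.exp (Complex.I * (x * (a - b) : ℝ)) - 1) := by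
    rw [mul_sub, mul_one, ← Complex.exp_add]
    congr 2 <;> (push_cast; ring)
  rw [h, norm_mul, Complex.norm_exp_ofReal_mul_I, one_mul, ← abs_mul]
  exact Real.norm_exp_I_mul_ofReal_sub_one_le

namespace Admissible

variable {K : ℝ} {C : ℕ → ℝ} {w : ℝ → ℝ}

theorem integrable_dual_mul_exp (hw : Admissible K C w) (x : ℝ) {φ : ℝ → ℝ} (hφ : Continuous φ) :
    Integrable fun t => hw.dual t * Complex.exp (Complex.I * x * φ t) := by
  refine hw.dual.integrable.mul_bdd (c := 1) (by fun_prop)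
    (Filter.Eventually.of_forall fun t => ?_)
  rw [show Complex.I * x * φ t = ((x * φ t : ℝ) : ℂ) * Complex.I by push_cast; ring,
    Complex.norm_exp_ofReal_mul_I]

theorem norm_integral_dual_exp_sub_le (hw : Admissible K C w) (hK : 0 < K) (x : ℝ)
    {φ ψ : ℝ → ℝ} (hφ : Continuous φ) (hψ : Continuous ψ)
    (h : ∀ t, |φ t - ψ t| ≤ |2 * π * t| ^ 3) :
    ‖(∫ t, hw.dual t * Complex.exp (Complex.I * x * φ t)) -
        ∫ t, hw.dual t * Complex.exp (Complex.I * x * ψ t)‖ ≤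
      |x| * (2 * π) ^ 3 * ((C 3 + C 5) * π) / K ^ 3 := by
  rw [← integral_sub (hw.integrable_dual_mul_exp x hφ) (hw.integrable_dual_mul_exp x hψ)]
  simp_rw [← mul_sub]
  refine hw.norm_integral_dual_mul_le hK (by positivity) fun t => ?_
  refine (Complex.norm_exp_I_mul_sub_exp_I_mul_le _ _ _).trans ?_
  rw [mul_assoc]
  gcongr
  refine (h t).trans_eq ?_
  rw [abs_mul, mul_pow, abs_of_pos (by positivity : 0 < 2 * π)]

theorem integral_dual_mul_exp_neg (hw : Admissible K C w) (x : ℝ) {φ : ℝ → ℝ}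
    (hφ : ∀ t, φ (-t) = φ t) :
    ∫ t, hw.dual t * Complex.exp (Complex.I * x * (-φ t : ℝ)) =
      conj (∫ t, hw.dual t * Complex.exp (Complex.I * x * φ t)) := by
  rw [← integral_conj, ← integral_neg_eq_self]
  congr 1 with t
  rw [map_mul, hw.conj_dual, ← Complex.exp_conj, hφ]
  simp

end Admissible

theorem besselJ_eq (n : ℕ) (x : ℝ) :
    besselJ n x = ∫ t in (-(1:ℝ)/2)..(1/2), Complex.exp (2 * π * Complex.I * (n * t)) *
      Complex.exp (Complex.I * x * (-Real.sin (2 * π * t) : ℝ)) := by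
  simp only [besselJ, e]
  congr 1 with t
  push_cast
  ring_nf

theorem Real.periodic_sin_two_pi_mul_sub (c : ℝ) :
    Function.Periodic (fun t => Real.sin (2 * π * t - c)) 1 := by
  intro t
  simp only
  rw [show 2 * π * (t + 1) - c = 2 * π * t - c + 2 * π by ring, Real.sin_add_two_pi]

theorem integral_exp_mul_shift (n r : ℕ) (x : ℝ) :
    ∫ t in (-(1:ℝ)/2)..(1/2), Complex.exp (2 * π * Complex.I * (n * t)) *
      Complex.exp (Complex.I * x * (-Real.sin (2 * π * t - r * (π / 2)) : ℝ)) =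
      Complex.I ^ (n * r) * besselJ n x := by
  set H : ℝ → ℂ := fun t => Complex.exp (2 * π * Complex.I * (n * t)) *
      Complex.exp (Complex.I * x * (-Real.sin (2 * π * t) : ℝ)) with hH
  have hper : Function.Periodic H 1 := by
    intro t
    have h1 := Real.periodic_sin_two_pi_mul_sub 0 t
    simp only [sub_zero] at h1
    simp only [hH, h1]
    congr 1
    rw [Complex.exp_eq_exp_iff_exists_int]
    exact ⟨n, by push_cast; ring⟩
  have hpt : ∀ t : ℝ, Complex.exp (2 * π * Complex.I * (n * t)) *
      Complex.exp (Complex.I * x * (-Real.sin (2 * π * t - r * (π / 2)) : ℝ)) =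
      Complex.I ^ (n * r) * H (t - r / 4) := by
    intro t
    have hI : Complex.I ^ (n * r) = Complex.exp ((n * r : ℕ) * (π / 2 * Complex.I)) := by
      rw [Complex.exp_nat_mul, Complex.exp_pi_div_two_mul_I]
    have hs : 2 * π * (t - r / 4) = 2 * π * t - r * (π / 2) := by ring
    simp only [hH, hs]
    rw [hI, ← mul_assoc (Complex.exp _) (Complex.exp _)]
    congr 1
    rw [← Complex.exp_add]
    congr 1
    push_cast
    ring
  simp_rw [hpt, intervalIntegral.integral_const_mul]
  rw [besselJ_eq, intervalIntegral.integral_comp_sub_right]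
  congr 1
  have := hper.intervalIntegral_add_eq (-(1:ℝ)/2 - r / 4) (-(1:ℝ)/2)
  rw [show -(1:ℝ)/2 - r / 4 + 1 = 1/2 - r / 4 by ring, show -(1:ℝ)/2 + 1 = 1/2 by ring] at this
  exact this

theorem Complex.sum_range_four_I_pow_pow (m : ℕ) :
    ∑ r ∈ Finset.range 4, (Complex.I ^ m) ^ r = if m % 4 = 0 then 4 else 0 := by
  have hmod : Complex.I ^ m = Complex.I ^ (m % 4) := by
    conv_lhs => rw [← Nat.div_add_mod m 4, pow_add, pow_mul, Complex.I_pow_four, one_pow, one_mul]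
  rw [hmod]
  have : m % 4 < 4 := Nat.mod_lt _ (by norm_num)
  interval_cases m % 4 <;> simp [Finset.sum_range_succ, pow_succ]

/-- The combination of quarter-period translates of `t ↦ exp (-i x sin (2πt))` whose Fourier
coefficients pick out one residue class modulo `4`. -/
noncomputable def besselKernel (a : ℕ) (x t : ℝ) : ℂ :=
  ∑ r ∈ Finset.range 4, (Complex.I ^ (a + 1)) ^ r *
    Complex.exp (Complex.I * x * (-Real.sin (2 * π * t - r * (π / 2)) : ℝ))

theorem continuous_besselKernel (a : ℕ) (x : ℝ) : Continuous (besselKernel a x) := by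
  unfold besselKernel
  fun_prop

theorem periodic_besselKernel (a : ℕ) (x : ℝ) : Function.Periodic (besselKernel a x) 1 := by
  intro t
  refine Finset.sum_congr rfl fun r _ => ?_
  have := Real.periodic_sin_two_pi_mul_sub (r * (π / 2)) t
  simp only at this
  rw [this]

theorem integral_exp_mul_besselKernel {a : ℕ} (ha : a = 0 ∨ a = 2) (n : ℕ) (x : ℝ) :
    ∫ t in (-(1:ℝ)/2)..(1/2), Complex.exp (2 * π * Complex.I * (n * t)) * besselKernel a x t =
      if (n + 1) % 4 = a then 4 * besselJ n x else 0 := by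
  simp only [besselKernel, Finset.mul_sum]
  rw [intervalIntegral.integral_finsetSum
    fun r _ => Continuous.intervalIntegrable (by fun_prop) _ _]
  have h : ∀ r ∈ Finset.range 4, ∫ t in (-(1:ℝ)/2)..(1/2),
      Complex.exp (2 * π * Complex.I * (n * t)) * ((Complex.I ^ (a + 1)) ^ r *
        Complex.exp (Complex.I * x * (-Real.sin (2 * π * t - r * (π / 2)) : ℝ))) =
      (Complex.I ^ (a + 1 + n)) ^ r * besselJ n x := by
    intro r _
    simp_rw [mul_left_comm _ ((Complex.I ^ (a + 1)) ^ r), intervalIntegral.integral_const_mul,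
      integral_exp_mul_shift]
    ring
  rw [Finset.sum_congr rfl h, ← Finset.sum_mul, Complex.sum_range_four_I_pow_pow, ite_mul,
    zero_mul]
  congr 1
  rw [eq_iff_iff]
  omega

theorem besselKernel_eq {a : ℕ} (ha : a = 0 ∨ a = 2) (x t : ℝ) :
    besselKernel a x t = Complex.exp (Complex.I * x * (-Real.sin (2 * π * t) : ℝ)) +
      Complex.I ^ (a + 1) * Complex.exp (Complex.I * x * (Real.cos (2 * π * t) : ℝ)) -
      Complex.exp (Complex.I * x * (Real.sin (2 * π * t) : ℝ)) -
      Complex.I ^ (a + 1) * Complex.exp (Complex.I * x * (-Real.cos (2 * π * t) : ℝ)) := by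
  have h1 : Real.sin (2 * π * t - π / 2) = -Real.cos (2 * π * t) := Real.sin_sub_pi_div_two _
  have h2 : Real.sin (2 * π * t - 2 * (π / 2)) = -Real.sin (2 * π * t) := by
    rw [mul_div_cancel₀ _ two_ne_zero, Real.sin_sub_pi]
  have h3 : Real.sin (2 * π * t - 3 * (π / 2)) = Real.cos (2 * π * t) := by
    rw [show 2 * π * t - 3 * (π / 2) = 2 * π * t + π / 2 - 2 * π by ring, Real.sin_sub_two_pi,
      Real.sin_add_pi_div_two]
  have hsq : (Complex.I ^ (a + 1)) ^ 2 = -1 := by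
    rcases ha with rfl | rfl <;> norm_num [pow_succ]
  have hcube : (Complex.I ^ (a + 1)) ^ 3 = -Complex.I ^ (a + 1) := by
    rw [pow_succ, hsq, neg_one_mul]
  simp only [besselKernel, Finset.sum_range_succ, Finset.sum_range_zero, Nat.cast_zero,
    Nat.cast_one, Nat.cast_ofNat, zero_mul, one_mul, sub_zero, zero_add, pow_zero, pow_one, h1, h2,
    h3, hsq, hcube, neg_neg]
  ring

namespace Admissible

variable {K : ℝ} {C : ℕ → ℝ} {w : ℝ → ℝ}

theorem four_mul_tsum_eq_integral (hw : Admissible K C w) (hK : 0 < K) {a : ℕ}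
    (ha : a = 0 ∨ a = 2) (x : ℝ) :
    4 * (∑' k : ℕ, if 1 ≤ k ∧ k % 4 = a then (w (k - 1 : ℕ) : ℂ) * besselJ (k - 1) x else 0) =
      ∫ t, hw.dual t * besselKernel a x t := by
  obtain ⟨N, hN⟩ := exists_nat_gt (2 * K)
  have hlarge : ∀ n : ℕ, N ≤ n → w n = 0 := fun n hn => hw.eq_zero fun h => by
    have : (N : ℝ) ≤ n := by exact_mod_cast hn
    linarith [h.2]
  rw [hw.dual.integral_mul_periodic (continuous_besselKernel a x) (periodic_besselKernel a x)
    ((Finset.range N).map Nat.castEmbedding), Finset.sum_map,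
    tsum_eq_sum (s := Finset.range (N + 1)), Finset.sum_range_succ']
  · simp only [nonpos_iff_eq_zero, one_ne_zero, false_and, if_false, add_zero, Finset.mul_sum]
    refine Finset.sum_congr rfl fun n _ => ?_
    have := integral_exp_mul_besselKernel ha n x
    simp only [Nat.castEmbedding_apply, Int.cast_natCast, hw.fourier_dual, toSchwartz_apply, this,
      Nat.add_sub_cancel, Nat.le_add_left, true_and, mul_ite, mul_zero]
    split_ifs
    · ring
    · rfl
  · intro k hk
    rw [Finset.mem_range, not_lt] at hk
    rw [hlarge (k - 1) (by omega)]
    simp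
  · intro n hn
    rw [hw.fourier_dual, toSchwartz_apply, ofReal_eq_zero]
    rcases lt_or_ge n 0 with h | h
    · refine hw.eq_zero fun h' => ?_
      have : (n : ℝ) < 0 := by exact_mod_cast h
      linarith [h'.1]
    · lift n to ℕ using h
      rw [Int.cast_natCast]
      refine hlarge n (not_lt.mp fun h => hn ?_)
      exact Finset.mem_map.mpr ⟨n, Finset.mem_range.mpr h, rfl⟩

theorem norm_four_mul_tsum_sub_le (hw : Admissible K C w) (hK : 0 < K) {a : ℕ}
    (ha : a = 0 ∨ a = 2) {x : ℝ} (hx : 0 < x) :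
    ‖4 * (∑' k : ℕ, if 1 ≤ k ∧ k % 4 = a then
          (w (k - 1 : ℕ) : ℂ) * besselJ (k - 1) x else 0)
        - (w x : ℂ) + Complex.I ^ a * ((gfun w x : ℝ) : ℂ)‖ ≤
      4 * (x * (2 * π) ^ 3 * ((C 3 + C 5) * π) / K ^ 3) := by
  set B := x * (2 * π) ^ 3 * ((C 3 + C 5) * π) / K ^ 3 with hB
  set P : (ℝ → ℝ) → ℂ := fun φ => ∫ t, hw.dual t * Complex.exp (Complex.I * x * (φ t : ℝ)) with hP
  have hbound : ∀ φ ψ : ℝ → ℝ, Continuous φ → Continuous ψ →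
      (∀ t, |φ t - ψ t| ≤ |2 * π * t| ^ 3) → ‖P φ - P ψ‖ ≤ B := fun φ ψ hφ hψ h => by
    simpa [abs_of_pos hx] using hw.norm_integral_dual_exp_sub_le hK x hφ hψ h
  have hsplit : ∫ t, hw.dual t * besselKernel a x t =
      P (fun t => -Real.sin (2 * π * t)) + Complex.I ^ (a + 1) * P (fun t => Real.cos (2 * π * t))
      - P (fun t => Real.sin (2 * π * t))
      - Complex.I ^ (a + 1) * P (fun t => -Real.cos (2 * π * t)) := by
    have hint := fun (φ : ℝ → ℝ) (hφ : Continuous φ) => hw.integrable_dual_mul_exp x hφ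
    have i1 := hint (fun t => -Real.sin (2 * π * t)) (by fun_prop)
    have i2 := (hint (fun t => Real.cos (2 * π * t)) (by fun_prop)).const_mul (Complex.I ^ (a + 1))
    have i3 := hint (fun t => Real.sin (2 * π * t)) (by fun_prop)
    have i4 := (hint (fun t => -Real.cos (2 * π * t)) (by fun_prop)).const_mul
      (Complex.I ^ (a + 1))
    simp only [hP, ← integral_const_mul]
    refine Eq.trans ?_ ((integral_sub ((i1.add i2).sub i3) i4).trans (congrArg (· - _)
      ((integral_sub (i1.add i2) i3).trans (congrArg (· - _) (integral_add i1 i2)))))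
    congr 1 with t
    simp only [besselKernel_eq ha, Pi.add_apply, Pi.sub_apply]
    ring
  have hw1 : P (fun t => -(2 * π * t)) = w x := by
    rw [← hw.integral_dual_mul_exp x]
    simp only [hP]
    congr 1 with t
    push_cast
    ring_nf
  have hw2 : P (fun t => 2 * π * t) = 0 := by
    have h0 : w (-x) = 0 := hw.eq_zero fun h => by linarith [h.1]
    have := hw.integral_dual_mul_exp (-x)
    rw [h0, ofReal_zero] at this
    rw [← this]
    simp only [hP]
    congr 1 with t
    push_cast
    ring_nf
  set A := P fun t => 1 - (2 * π * t) ^ 2 / 2 with hA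
  have hconj : P (fun t => -(1 - (2 * π * t) ^ 2 / 2)) = conj A :=
    hw.integral_dual_mul_exp_neg x fun t => by ring
  have hg : Complex.I ^ a * (gfun w x : ℂ) = -(Complex.I ^ (a + 1) * (A - conj A)) := by
    have h : gfun w x = 2 * A.im := hw.gfun_eq_integral hK hx
    rw [h, Complex.sub_conj, pow_succ]
    push_cast
    linear_combination (2 * Complex.I ^ a * (A.im : ℂ)) * Complex.I_sq
  have hsin : ∀ t, |Real.sin (2 * π * t) - 2 * π * t| ≤ |2 * π * t| ^ 3 := fun t =>
    Real.abs_sin_sub_self_le _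
  have hcos : ∀ t, |Real.cos (2 * π * t) - (1 - (2 * π * t) ^ 2 / 2)| ≤ |2 * π * t| ^ 3 := fun t =>
    Real.abs_cos_sub_quadratic_le _
  have b1 := hbound (fun t => -Real.sin (2 * π * t)) (fun t => -(2 * π * t)) (by fun_prop)
    (by fun_prop) fun t => by rw [← neg_sub', abs_neg]; exact hsin t
  have b2 := hbound (fun t => Real.cos (2 * π * t)) (fun t => 1 - (2 * π * t) ^ 2 / 2)
    (by fun_prop) (by fun_prop) hcos
  have b3 := hbound (fun t => Real.sin (2 * π * t)) (fun t => 2 * π * t) (by fun_prop)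
    (by fun_prop) hsin
  have b4 := hbound (fun t => -Real.cos (2 * π * t)) (fun t => -(1 - (2 * π * t) ^ 2 / 2))
    (by fun_prop) (by fun_prop) fun t => by rw [← neg_sub', abs_neg]; exact hcos t
  rw [hw1] at b1
  rw [hw2, sub_zero] at b3
  rw [hconj] at b4
  have hnormI : ‖Complex.I ^ (a + 1)‖ = 1 := by rw [norm_pow, Complex.norm_I, one_pow]
  rw [hw.four_mul_tsum_eq_integral hK ha, hsplit, hg]
  calc _ = ‖(P (fun t => -Real.sin (2 * π * t)) - w x)
        + Complex.I ^ (a + 1) * (P (fun t => Real.cos (2 * π * t)) - A)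
        - P (fun t => Real.sin (2 * π * t))
        - Complex.I ^ (a + 1) * (P (fun t => -Real.cos (2 * π * t)) - conj A)‖ := by
        congr 1; ring
    _ ≤ B + B + B + B := by
        refine (norm_sub_le _ _).trans (add_le_add ((norm_sub_le _ _).trans (add_le_add
          ((norm_add_le _ _).trans (add_le_add b1 ?_)) b3)) ?_)
        · rwa [norm_mul, hnormI, one_mul]
        · rwa [norm_mul, hnormI, one_mul]
    _ = 4 * B := by ring

end Admissible

theorem stmt16 (C : ℕ → ℝ) (hC : ∀ j, 0 < C j) :
    (∃ Cb : ℝ, 0 < Cb ∧ ∀ K : ℝ, 1 ≤ K → ∀ w : ℝ → ℝ, Admissible K C w →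
      ∀ a : ℕ, (a = 0 ∨ a = 2) → ∀ x : ℝ, 0 < x →
      ‖4 * (∑' k : ℕ, if 1 ≤ k ∧ k % 4 = a then
            (w (k - 1 : ℕ) : ℂ) * besselJ (k - 1) x else 0)
        - (w x : ℂ) + Complex.I ^ a * ((gfun w x : ℝ) : ℂ)‖ ≤ Cb * x / K ^ 3) ∧
    ∀ j : ℕ, ∃ C' : ℝ, 0 < C' ∧ ∀ K : ℝ, 1 ≤ K → ∀ w : ℝ → ℝ, Admissible K C w →
      ∀ x : ℝ, 0 < x → |gfun w x| ≤ C' * (x * K ^ (-2 : ℤ)) ^ j := by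
  refine ⟨⟨4 * ((2 * π) ^ 3 * ((C 3 + C 5) * π)), ?_, fun K hK w hw a ha x hx => ?_⟩, fun j => ?_⟩
  · have := hC 3
    have := hC 5
    positivity
  · exact (hw.norm_four_mul_tsum_sub_le (by linarith) ha hx).trans_eq (by ring)
  · obtain ⟨D, hD, h⟩ := Admissible.exists_abs_gfun_le_pow C j
    refine ⟨D, hD, fun K hK w hw x hx => ?_⟩
    have hKpow : K ^ (-2 : ℤ) = (K ^ 2)⁻¹ := by rw [zpow_neg]; norm_cast
    rw [hKpow, ← div_eq_mul_inv]
    exact h K (by linarith) w hw x hx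
end
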